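/- arXiv:2012.10624 — 2 statements merged into one kernel-verified Lean document; each statement's English description precedes it below -/
import Mathlib

section
/- Every finite simple graph of chromatic number six contains four cycles of consecutive lengths which start with an odd number; that is, there exists a positive integer m such that the graph contains cycles of lengths 2m+1, 2m+2, 2m+3 and 2m+4, respectively. -/
/-- `G` contains a cycle of length `n`. -/
def HasCycleLength {V : Type*} (G : SimpleGraph V) (n : ℕ) : Prop :=
  ∃ (u : V) (c : G.Walk u u), c.IsCycle ∧ c.length = n

namespace FC
open SimpleGraph

variable {V : Type*} {G : SimpleGraph V}

/-- four consecutive cycle lengths -/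
def Done (G : SimpleGraph V) : Prop := ∃ m : ℕ, 0 < m ∧ ∀ i < 4, HasCycleLength G (2 * m + 1 + i)

theorem three_le {n : ℕ} (h : HasCycleLength G n) : 3 ≤ n := by
  obtain ⟨u, c, hc, rfl⟩ := h
  exact hc.three_le_length

theorem nd4 (hD : ¬ Done G) (n : ℕ) (hn : n % 2 = 1) (h0 : HasCycleLength G n)
    (h1 : HasCycleLength G (n+1)) (h2 : HasCycleLength G (n+2)) (h3 : HasCycleLength G (n+3)) :
    False := by
  have := three_le h0
  apply hD
  refine ⟨n / 2, by omega, ?_⟩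
  have e : 2 * (n/2) + 1 = n := by omega
  rw [e]
  intro i hi
  interval_cases i <;> assumption

theorem cyc_congr {n m : ℕ} (h : HasCycleLength G n) (e : n = m) : HasCycleLength G m := e ▸ h

theorem edge_len {u w : V} (p : G.Walk u w) (hp : p.IsPath) (he : s(u, w) ∈ p.edges) :
    p.length = 1 := by
  cases p with
  | nil => simp at he
  | cons h q =>
    rw [Walk.cons_isPath_iff] at hp
    rw [Walk.edges_cons, List.mem_cons] at he
    rcases he with he | he
    · rw [Sym2.eq_iff] at he
      rcases he with ⟨_, e⟩ | ⟨e1, e2⟩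
      · subst e
        have := hp.1
        rw [Walk.isPath_iff_nil] at this
        simp [Walk.length_eq_zero_iff.mpr this]
      · subst e1
        exact absurd rfl (h.ne)
    · exact absurd (Walk.fst_mem_support_of_mem_edges q he) hp.2

theorem cyc_of_path {u w : V} (p : G.Walk u w) (hp : p.IsPath) (h : G.Adj w u) (hl : 2 ≤ p.length) :
    HasCycleLength G (p.length + 1) := by
  refine ⟨w, Walk.cons h p, ?_, by simp⟩
  rw [Walk.cons_isCycle_iff]
  refine ⟨hp, fun he => ?_⟩
  rw [Sym2.eq_swap] at he
  have := edge_len p hp he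
  omega

/-- path inside a set -/
def Pth (G : SimpleGraph V) (S : Set V) (u w : V) (n : ℕ) : Prop :=
  ∃ p : G.Walk u w, p.IsPath ∧ p.length = n ∧ ∀ v ∈ p.support, v ∈ S

theorem Pth.nil {S : Set V} {u : V} (h : u ∈ S) : Pth G S u u 0 :=
  ⟨Walk.nil, by simp, by simp, by simpa using h⟩

theorem Pth.cons {S T : Set V} {u v w : V} {n : ℕ} (h : G.Adj u v) (hp : Pth G S v w n)
    (hu : u ∉ S) (hT : u ∈ T) (hST : S ⊆ T) : Pth G T u w (n+1) := by
  obtain ⟨p, h1, h2, h3⟩ := hp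
  refine ⟨Walk.cons h p, ?_, by simp [h2], ?_⟩
  · rw [Walk.cons_isPath_iff]; exact ⟨h1, fun hm => hu (h3 _ hm)⟩
  · intro x hx
    rw [Walk.support_cons, List.mem_cons] at hx
    rcases hx with rfl | hx
    · exact hT
    · exact hST (h3 _ hx)

theorem Pth.mono {S T : Set V} {u w : V} {n : ℕ} (hp : Pth G S u w n) (hST : S ⊆ T) :
    Pth G T u w n := by
  obtain ⟨p, h1, h2, h3⟩ := hp
  exact ⟨p, h1, h2, fun v hv => hST (h3 v hv)⟩

theorem Pth.symm {S : Set V} {u w : V} {n : ℕ} (hp : Pth G S u w n) : Pth G S w u n := by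
  obtain ⟨p, h1, h2, h3⟩ := hp
  exact ⟨p.reverse, by simpa using h1, by simpa using h2, fun v hv => h3 v (by simpa using hv)⟩

/-- concatenation via an edge of disjoint paths -/
theorem Pth.link {S T : Set V} {u v v' w : V} {n m : ℕ} (hp : Pth G S u v n) (h : G.Adj v v')
    (hq : Pth G T v' w m) (hd : Disjoint S T) : Pth G (S ∪ T) u w (n + 1 + m) := by
  obtain ⟨p, h1, h2, h3⟩ := hp
  induction p generalizing n S with
  | nil =>
    obtain rfl : n = 0 := by simpa using h2.symm
    rename_i u0
    have hu : u0 ∈ S := h3 _ (by simp)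
    have := Pth.cons h hq (Set.disjoint_left.mp hd hu) (Or.inl hu : _ ∈ S ∪ T) Set.subset_union_right
    rwa [show 0 + 1 + m = m + 1 by omega]
  | @cons a b c hab p ih =>
    rw [Walk.cons_isPath_iff] at h1
    have ha : a ∈ S := h3 _ (by simp)
    have := ih (S := S \ {a}) (n := p.length) h
      (hd.mono_left Set.sdiff_subset) h1.1 rfl (by
        intro x hx
        refine ⟨h3 _ (by simp [hx]), fun e => ?_⟩
        rw [Set.mem_singleton_iff] at e
        exact h1.2 (e ▸ hx))
    have := Pth.cons hab this (T := S ∪ T) (by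
      rintro (h | h)
      · exact h.2 rfl
      · exact Set.disjoint_left.mp hd ha h) (Or.inl ha)
      (Set.union_subset_union_left _ Set.sdiff_subset)
    convert this using 1
    simp at h2; omega

theorem Pth.cyc {S : Set V} {u w : V} {n : ℕ} (hp : Pth G S u w n) (h : G.Adj w u) (hl : 2 ≤ n) :
    HasCycleLength G (n + 1) := by
  obtain ⟨p, h1, h2, h3⟩ := hp
  have := cyc_of_path p h1 h (by omega)
  rwa [h2] at this

theorem Pth.left {S : Set V} {u w : V} {n : ℕ} (hp : Pth G S u w n) : u ∈ S := by
  obtain ⟨p, h1, h2, h3⟩ := hp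
  exact h3 _ (by simp)

theorem Pth.right {S : Set V} {u w : V} {n : ℕ} (hp : Pth G S u w n) : w ∈ S := by
  obtain ⟨p, h1, h2, h3⟩ := hp
  exact h3 _ (by simp)

theorem Pth.ne {S : Set V} {u w : V} {n : ℕ} (hp : Pth G S u w n) (hn : 0 < n) : u ≠ w := by
  obtain ⟨p, h1, h2, h3⟩ := hp
  rintro rfl
  rw [Walk.isPath_iff_nil, ← Walk.length_eq_zero_iff] at h1
  omega

theorem pth_list {S : Set V} (l : List V) (u w : V) (hc : (u :: l).IsChain G.Adj := by
      simp only [List.isChain_cons_cons, List.isChain_singleton, and_true]; grind [SimpleGraph.adj_comm])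
    (hn : (u :: l).Nodup := by grind [SimpleGraph.Adj.ne]) (hw : (u :: l).getLast (by simp) = w := by rfl) (hS : ∀ x ∈ u :: l, x ∈ S := by grind) :
    Pth G S u w l.length := by
  have key : ∀ (l : List V) (u w : V), (u :: l).IsChain G.Adj →
    (u :: l).Nodup → (u :: l).getLast (by simp) = w →
    Pth G {x | x ∈ u :: l} u w l.length := by
    intro l
    induction l with
    | nil => intro u w _ _ hw; simp at hw; subst hw; exact Pth.nil (by simp)
    | cons a l ih =>
      intro u w hc hn hw
      rw [List.isChain_cons_cons] at hc
      rw [List.nodup_cons] at hn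
      have := ih a w hc.2 hn.2 (by simpa using hw)
      exact Pth.cons hc.1 this hn.1 (by simp) (fun x hx => by simp at hx ⊢; tauto)
  exact (key l u w hc hn hw).mono hS

theorem cyc_list (l : List V) (u : V) (hc : (u :: l).IsChain G.Adj := by
      simp only [List.isChain_cons_cons, List.isChain_singleton, and_true]; grind [SimpleGraph.adj_comm])
    (hn : (u :: l).Nodup := by grind [SimpleGraph.Adj.ne]) (hw : G.Adj ((u :: l).getLast (by simp)) u := by grind [SimpleGraph.adj_comm]) (h2 : 2 ≤ l.length := by simp) :
    HasCycleLength G (l.length + 1) :=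
  (pth_list (S := Set.univ) l u _ hc hn rfl (by simp)).cyc hw h2


end FC

namespace FC
open SimpleGraph

variable {V : Type*} {G : SimpleGraph V}

/-- breadth first search data -/
structure BFS (G : SimpleGraph V) where
  lev : V → ℕ
  par : V → V
  par_adj : ∀ v, 0 < lev v → G.Adj v (par v)
  par_lev : ∀ v, 0 < lev v → lev (par v) + 1 = lev v
  root : ∀ u v, lev u = 0 → lev v = 0 → u = v
  adj_lev : ∀ u v, G.Adj u v → lev u ≤ lev v + 1

namespace BFS
variable (B : BFS G)

/-- layers -/
def L (i : ℕ) : Set V := {v | B.lev v = i}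

theorem mem_L {i : ℕ} {v : V} : v ∈ B.L i ↔ B.lev v = i := Iff.rfl

/-- gap to the common ancestor -/
noncomputable def g (u w : V) : ℕ := sInf {k | B.par^[k] u = B.par^[k] w}

theorem lev_iter (k : ℕ) : ∀ v, k ≤ B.lev v → B.lev (B.par^[k] v) + k = B.lev v := by
  induction k with
  | zero => simp
  | succ k ih =>
    intro v hv
    have h1 := B.par_lev v (by omega)
    rw [Function.iterate_succ_apply]
    have := ih (B.par v) (by omega)
    omega

theorem g_iff {u w : V} (h : B.lev u = B.lev w) {k : ℕ} :
    B.par^[k] u = B.par^[k] w ↔ B.g u w ≤ k := by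
  have hne : {k | B.par^[k] u = B.par^[k] w}.Nonempty :=
    ⟨B.lev u, B.root _ _ (by have := B.lev_iter (B.lev u) u le_rfl; omega)
      (by have := B.lev_iter (B.lev u) w h.le; omega)⟩
  constructor
  · intro hk; exact Nat.sInf_le hk
  · intro hk
    have h0 : B.par^[B.g u w] u = B.par^[B.g u w] w := Nat.sInf_mem hne
    obtain ⟨d, rfl⟩ := Nat.exists_eq_add_of_le hk
    rw [add_comm, Function.iterate_add_apply, Function.iterate_add_apply, h0]

theorem g_symm (u w : V) : B.g u w = B.g w u := by
  unfold g; congr 1; ext k; exact eq_comm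

theorem g_self (u : V) : B.g u u = 0 := by
  have := (B.g_iff (u := u) (w := u) rfl (k := 0)).mp rfl
  omega

theorem g_pos {u w : V} (h : B.lev u = B.lev w) (hne : u ≠ w) : 0 < B.g u w := by
  by_contra h0
  exact hne ((B.g_iff h (k := 0)).mpr (by omega))

theorem ultra {u v w : V} (h : B.lev u = B.lev v) (h' : B.lev v = B.lev w) :
    B.g u w ≤ max (B.g u v) (B.g v w) := by
  rw [← B.g_iff (h.trans h')]
  rw [(B.g_iff h).mpr (le_max_left _ _), (B.g_iff h').mpr (le_max_right _ _)]

theorem close_aux (k : ℕ) : ∀ (p w : V) (i n : ℕ), B.g p w = k → B.lev p = i → B.lev w = i → p ≠ w →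
    Pth G {x | i ≤ B.lev x} p w n → HasCycleLength G (n + 2 * k) := by
  induction k with
  | zero =>
    intro p w i n hg hp hw hne _
    have := B.g_pos (hp.trans hw.symm) hne
    omega
  | succ k ih =>
    intro p w i n hg hp hw hne hP
    have hn : 1 ≤ n := by
      obtain ⟨q, _, h2, _⟩ := hP
      rcases Nat.eq_zero_or_pos n with h | h
      · subst h; exact absurd (Walk.eq_of_length_eq_zero h2) hne
      · exact h
    have hi : 0 < i := by
      rcases Nat.eq_zero_or_pos i with h | h
      · exact absurd (B.root p w (by omega) (by omega)) hne
      · exact h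
    have a1 := B.par_adj p (by omega)
    have a2 := B.par_adj w (by omega)
    have l1 := B.par_lev p (by omega)
    have l2 := B.par_lev w (by omega)
    have c1 : Pth G ({x | i ≤ B.lev x} ∪ {B.par p}) (B.par p) w (n+1) :=
      Pth.cons a1.symm hP (by simp; omega) (by simp) (by simp)
    by_cases he : B.par p = B.par w
    · have : B.g p w ≤ 1 := (B.g_iff (hp.trans hw.symm) (k := 1)).mp (by simpa using he)
      have hk : k = 0 := by omega
      subst hk
      have := c1.cyc (he ▸ a2) (by omega)
      exact this
    · have c2 := Pth.cons a2.symm c1.symm (T := {x | i - 1 ≤ B.lev x}) (by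
        rintro (h | h)
        · simp at h; omega
        · exact he h.symm) (by simp; omega) (by
        rintro x (h | h)
        · simp at h ⊢; omega
        · simp at h ⊢; subst h; omega)
      have hlev : B.lev (B.par p) = B.lev (B.par w) := by omega
      have hgk : B.g (B.par p) (B.par w) = k := by
        apply le_antisymm
        · rw [← B.g_iff hlev]
          have := (B.g_iff (hp.trans hw.symm) (k := k+1)).mpr (by omega)
          simpa using this
        · have h1 := (B.g_iff hlev (k := B.g (B.par p) (B.par w))).mpr le_rfl
          have h2 := (B.g_iff (hp.trans hw.symm) (k := B.g (B.par p) (B.par w) + 1)).mp (by simpa using h1)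
          omega
      have := ih (B.par p) (B.par w) (i-1) (n+2) hgk (by omega) (by omega) he c2.symm
      exact cyc_congr this (by omega)

theorem close {p w : V} {i n : ℕ} (hP : Pth G {x | i ≤ B.lev x} p w n) (hp : B.lev p = i)
    (hw : B.lev w = i) (hne : p ≠ w) : HasCycleLength G (2 * B.g p w + n) :=
  cyc_congr (B.close_aux _ p w i n rfl hp hw hne hP) (by omega)

/-- close a path inside a layer -/
theorem closeL {p w : V} {i n : ℕ} (hP : Pth G (B.L i) p w n) (hne : p ≠ w) :
    HasCycleLength G (2 * B.g p w + n) :=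
  B.close (i := i) (hP.mono fun _ hx => (B.mem_L.mp hx).ge) hP.left hP.right hne

/-- close an explicit path -/
theorem cl (i : ℕ) (l : List V) (p w : V) {h : ℕ} (hg : B.g p w = h) (hne : p ≠ w)
    (hc : (p :: l).IsChain G.Adj := by
      simp only [List.isChain_cons_cons, List.isChain_singleton, and_true]; grind [SimpleGraph.adj_comm])
    (hn : (p :: l).Nodup := by grind [SimpleGraph.Adj.ne])
    (hw : (p :: l).getLast (by simp) = w := by rfl) (hS : ∀ x ∈ p :: l, x ∈ B.L i := by grind) :
    HasCycleLength G (2 * h + l.length) :=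
  hg ▸ B.closeL (pth_list l p w hc hn hw hS) hne

/-- conflict closing lemma -/
theorem conf {p z u' w' w : V} {i j l : ℕ} (hP : Pth G (B.L i \ {w}) p z j) (hz : G.Adj u' z)
    (hQ : Pth G (B.L (i+1)) u' w' l) (hw' : G.Adj w' w) (hw : B.lev w = i) :
    HasCycleLength G (2 * B.g p w + 2 + (l + j)) := by
  have c1 := hP.link hz.symm hQ (by
    rw [Set.disjoint_left]; rintro x ⟨h, _⟩ h'
    rw [mem_L] at h h'; omega)
  have c2 := c1.link hw' (Pth.nil (G := G) (S := {w}) rfl) (by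
    rw [Set.disjoint_left]; rintro x (⟨_, h⟩ | h') h2
    · exact h h2
    · rw [Set.mem_singleton_iff] at h2; subst h2; rw [mem_L] at h'; omega)
  have hne : p ≠ w := hP.left.2
  have c3 := c2.mono (T := {x | i ≤ B.lev x}) (by
    rintro x ((⟨h, _⟩ | h) | h)
    · rw [mem_L] at h; simp; omega
    · rw [mem_L] at h; simp; omega
    · rw [Set.mem_singleton_iff] at h; subst h; simp; omega)
  exact cyc_congr (B.close c3 hP.left.1 hw hne) (by omega)

theorem conf0 {z u' w' : V} {i l : ℕ} (hz : G.Adj u' z)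
    (hQ : Pth G (B.L (i+1)) u' w' l) (hw' : G.Adj w' z) (hw : B.lev z = i) (hl : 1 ≤ l) :
    HasCycleLength G (2 + l) := by
  have c2 := Pth.cons hz.symm hQ (T := Set.univ) (by rw [mem_L]; omega) trivial (by simp)
  exact cyc_congr (c2.cyc hw' (by omega)) (by omega)

/-- parent of a vertex in a layer -/
theorem exists_par {v : V} {i : ℕ} (h : v ∈ B.L (i+1)) : ∃ w, w ∈ B.L i ∧ G.Adj v w := by
  rw [mem_L] at h
  have := B.par_lev v (by omega)
  exact ⟨B.par v, by rw [mem_L]; omega, B.par_adj v (by omega)⟩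

end BFS
end FC

namespace FC
open SimpleGraph

variable {V : Type*} {G : SimpleGraph V}

/-- an odd cycle, as a periodic function -/
structure OC (G : SimpleGraph V) (S : Set V) (n : ℕ) (c : ℕ → V) : Prop where
  odd : n % 2 = 1
  three : 3 ≤ n
  mem : ∀ k, c k ∈ S
  per : ∀ k, c (k + n) = c k
  adj : ∀ k, G.Adj (c k) (c (k + 1))
  inj : ∀ a b, a < n → b < n → c a = c b → a = b

theorem lab {n d : ℕ} {P : ℕ → Prop} (hper : ∀ k, P (k + n) ↔ P k) (hd : Nat.Coprime d n)
    (hn : 1 < n) (h : ∀ k, P k → P (k + d)) {a : ℕ} (b : ℕ) (ha : P a) : P b := by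
  obtain ⟨m, hm⟩ := Nat.exists_mul_mod_eq_one_of_coprime hd hn
  have h1 : ∀ t k, P k → P (k + d * t) := by
    intro t
    induction t with
    | zero => simp
    | succ t ih => intro k hk; have := h _ (ih k hk); rwa [mul_add, mul_one, ← add_assoc]
  have h2 : ∀ t k, P (k + n * t) ↔ P k := by
    intro t
    induction t with
    | zero => simp
    | succ t ih => intro k; rw [mul_add, mul_one, ← add_assoc, hper, ih]
  have h3 : ∀ k, P k → P (k + 1) := by
    intro k hk
    have := h1 m k hk
    have e := Nat.div_add_mod (d * m) n
    rw [hm.2] at e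
    rw [← e, show k + (n * (d * m / n) + 1) = (k + 1) + n * (d * m / n) by ring, h2] at this
    exact this
  have h4 : ∀ t, P (a + t) := by
    intro t
    induction t with
    | zero => exact ha
    | succ t ih => exact h3 _ ih
  have h5 := h4 (b + n * a - a)
  have : a ≤ n * a := Nat.le_mul_of_pos_left a (by omega)
  rw [show a + (b + n * a - a) = b + n * a by omega, h2] at h5
  exact h5

theorem lab_ex {n d : ℕ} {P : ℕ → Prop} (hper : ∀ k, P (k + n) ↔ P k) (hd : Nat.Coprime d n)
    (hn : 1 < n) {a b : ℕ} (ha : P a) (hb : ¬ P b) : ∃ k, P k ∧ ¬ P (k + d) := by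
  by_contra h
  push Not at h
  exact hb (lab hper hd hn h b ha)

theorem lab_same {n : ℕ} (d : ℕ) {P : ℕ → Prop} (hper : ∀ k, P (k + n) ↔ P k) (hn : n % 2 = 1) :
    ∃ k, (P k ↔ P (k + d)) := by
  by_contra h
  push Not at h
  have h0 : ∀ k, (P (k + d) ↔ ¬ P k) := fun k => by have := h k; tauto
  have h2 : ∀ t k, P (k + n * t) ↔ P k := by
    intro t
    induction t with
    | zero => simp
    | succ t ih => intro k; rw [mul_add, mul_one, ← add_assoc, hper, ih]
  have h1 : ∀ t, P (0 + d * (2 * t)) ↔ P 0 := by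
    intro t
    induction t with
    | zero => simp
    | succ t ih =>
      rw [show 0 + d * (2 * (t+1)) = (0 + d * (2 * t)) + d + d by ring, h0, h0, ih]; tauto
  have h3 := h1 (n / 2)
  have h4 := h0 (0 + d * (2 * (n/2)))
  rw [show 0 + d * (2 * (n/2)) + d = 0 + n * d by
    have : 2 * (n/2) + 1 = n := by omega
    calc 0 + d * (2 * (n/2)) + d = d * (2 * (n/2) + 1) := by ring
      _ = 0 + n * d := by rw [this]; ring, h2] at h4
  tauto

namespace OC
variable {S : Set V} {n : ℕ} {c : ℕ → V}

theorem per_mul (h : OC G S n c) (t k : ℕ) : c (k + n * t) = c k := by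
  induction t with
  | zero => simp
  | succ t ih => rw [mul_add, mul_one, ← add_assoc, h.per, ih]

theorem mod (h : OC G S n c) (k : ℕ) : c k = c (k % n) := by
  conv_lhs => rw [← Nat.mod_add_div k n]
  exact h.per_mul _ _

theorem eq_iff (h : OC G S n c) (a b : ℕ) : c a = c b ↔ a % n = b % n := by
  have := h.three
  constructor
  · intro e
    rw [h.mod a, h.mod b] at e
    exact h.inj _ _ (Nat.mod_lt _ (by omega)) (Nat.mod_lt _ (by omega)) e
  · intro e; rw [h.mod a, h.mod b, e]

theorem ne_add (h : OC G S n c) (a d : ℕ) (h0 : 0 < d) (hd : d < n) : c a ≠ c (a + d) := by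
  rw [Ne, h.eq_iff]
  intro e
  have : (a + 0) % n = (a + d) % n := e
  have := Nat.ModEq.add_left_cancel' a this
  unfold Nat.ModEq at this
  rw [Nat.mod_eq_of_lt hd, Nat.zero_mod] at this
  omega

theorem ne_of (h : OC G S n c) {a b : ℕ} (h0 : a < b) (hd : b < a + n) : c a ≠ c b := by
  have := h.ne_add a (b - a) (by omega) (by omega)
  rwa [show a + (b - a) = b by omega] at this

theorem shift (h : OC G S n c) (t : ℕ) : OC G S n (fun k => c (k + t)) where
  odd := h.odd
  three := h.three
  mem k := h.mem _
  per k := by rw [show k + n + t = k + t + n by omega, h.per]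
  adj k := by have := h.adj (k + t); rwa [show k + t + 1 = k + 1 + t by omega] at this
  inj a b ha hb e := by
    rcases lt_trichotomy a b with hab | hab | hab
    · exact absurd e (h.ne_of (by omega) (by omega))
    · exact hab
    · exact absurd e.symm (h.ne_of (by omega) (by omega))

theorem mono (h : OC G S n c) {T : Set V} (hT : ∀ k, c k ∈ T) : OC G T n c :=
  { h with mem := hT }

theorem pth' (h : OC G S n c) (d a : ℕ) (hd : d < n) :
    Pth G {x | ∃ k, a ≤ k ∧ k ≤ a + d ∧ x = c k} (c a) (c (a + d)) d := by
  induction d generalizing a with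
  | zero => exact Pth.nil ⟨a, by omega, by omega, rfl⟩
  | succ d ih =>
    have := ih (a+1) (by omega)
    rw [show a + 1 + d = a + (d + 1) by omega] at this
    refine Pth.cons (h.adj a) this ?_ ⟨a, by omega, by omega, rfl⟩ ?_
    · rintro ⟨k, h1, h2, h3⟩
      exact h.ne_of (by omega) (by omega) h3
    · rintro x ⟨k, h1, h2, h3⟩
      exact ⟨k, by omega, by omega, h3⟩

theorem pth (h : OC G S n c) (a d : ℕ) (hd : d < n) : Pth G S (c a) (c (a + d)) d :=
  (h.pth' d a hd).mono (by rintro x ⟨k, _, _, rfl⟩; exact h.mem k)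

end OC

theorem exists_max {P : ℕ → Prop} {b : ℕ} (h : ∃ k, P k) (hb : ∀ k, P k → k ≤ b) :
    ∃ m, P m ∧ ∀ k, P k → k ≤ m := by
  classical
  obtain ⟨k, hk⟩ := h
  refine ⟨Nat.findGreatest P b, Nat.findGreatest_spec (hb k hk) hk, fun j hj => Nat.le_findGreatest (hb j hj) hj⟩

/-- odd cycle within a layer, with maximal gap `h` -/
structure OCH (B : BFS G) (i n : ℕ) (c : ℕ → V) (h : ℕ) : Prop extends OC G (B.L i) n c where
  hle : ∀ a b, B.g (c a) (c b) ≤ h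
  hex : ∃ a b, B.g (c a) (c b) = h
  hpos : 0 < h

theorem OC.exists_h {B : BFS G} {i n : ℕ} {c : ℕ → V} (H : OC G (B.L i) n c) :
    ∃ h, OCH B i n c h := by
  obtain ⟨h, ⟨a, b, hab⟩, h2⟩ := exists_max (P := fun k => ∃ a b, B.g (c a) (c b) = k) (b := i)
    ⟨_, 0, 0, rfl⟩ (by
      rintro k ⟨a, b, rfl⟩
      have ha := B.mem_L.mp (H.mem a)
      have hb := B.mem_L.mp (H.mem b)
      rw [← B.g_iff (by omega)]
      apply B.root
      · have := B.lev_iter i (c a) (by omega); omega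
      · have := B.lev_iter i (c b) (by omega); omega)
  refine ⟨h, H, fun a b => h2 _ ⟨a, b, rfl⟩, ⟨a, b, hab⟩, ?_⟩
  have := B.g_pos (u := c 0) (w := c (0 + 1)) ((H.mem _).trans (H.mem _).symm) (H.adj 0).ne
  have := h2 _ ⟨_, _, rfl⟩ |>.trans' this
  exact this

namespace OCH
variable {B : BFS G} {i n h : ℕ} {c : ℕ → V}

theorem ul (H : OCH B i n c h) (a b d : ℕ) : B.g (c a) (c d) ≤ max (B.g (c a) (c b)) (B.g (c b) (c d)) :=
  B.ultra ((H.mem _).trans (H.mem _).symm) ((H.mem _).trans (H.mem _).symm)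

theorem dist (H : OCH B i n c h) (d : ℕ) (hd : Nat.Coprime d n) : ∃ k, B.g (c k) (c (k + d)) = h := by
  obtain ⟨a, b, hab⟩ := H.hex
  have := H.three
  obtain ⟨k, h1, h2⟩ := lab_ex (n := n) (d := d) (P := fun k => B.g (c a) (c k) < h) (a := a) (b := b)
    (fun k => by rw [H.per]) hd (by omega) (by rw [B.g_self]; exact H.hpos) (by omega)
  refine ⟨k, le_antisymm (H.hle _ _) ?_⟩
  have := H.ul a k (k + d)
  by_contra h3
  exact h2 (by omega)

theorem cop (H : OCH B i n c h) (d : ℕ) (hd : d = 1 ∨ d = 2 ∨ d = 4) : Nat.Coprime d n := by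
  have h2 : Nat.Coprime 2 n := by
    rw [Nat.coprime_two_left, Nat.odd_iff]; exact H.odd
  rcases hd with rfl | rfl | rfl
  · simp
  · exact h2
  · exact Nat.Coprime.mul_left h2 h2

theorem cyc (H : OCH B i n c h) {k d : ℕ} (hk : B.g (c k) (c (k + d)) = h) (h0 : 0 < d) (hd : d < n) :
    HasCycleLength G (2 * h + d) := by
  have := B.closeL (H.pth k d hd) (H.ne_add k d h0 hd)
  rwa [hk] at this

theorem cyc1 (H : OCH B i n c h) : HasCycleLength G (2 * h + 1) := by
  obtain ⟨k, hk⟩ := H.dist 1 (H.cop 1 (by simp))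
  exact H.cyc hk (by omega) (by have := H.three; omega)

theorem cyc2 (H : OCH B i n c h) : HasCycleLength G (2 * h + 2) := by
  obtain ⟨k, hk⟩ := H.dist 2 (H.cop 2 (by simp))
  exact H.cyc hk (by omega) (by have := H.three; omega)

theorem cyc4 (H : OCH B i n c h) (hn : 5 ≤ n) : HasCycleLength G (2 * h + 4) := by
  obtain ⟨k, hk⟩ := H.dist 4 (H.cop 4 (by simp))
  exact H.cyc hk (by omega) (by omega)

theorem no3 (H : OCH B i n c h) (hD : ¬ Done G) (hn : 5 ≤ n) (h3 : HasCycleLength G (2 * h + 3)) : False :=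
  nd4 hD (2 * h + 1) (by omega) H.cyc1 H.cyc2 h3 (H.cyc4 hn)

theorem d3 (H : OCH B i n c h) (hD : ¬ Done G) (hn : 5 ≤ n) (k : ℕ) : B.g (c k) (c (k + 3)) < h := by
  rcases lt_or_eq_of_le (H.hle k (k+3)) with h' | h'
  · exact h'
  · exact (H.no3 hD hn (H.cyc h' (by omega) (by omega))).elim

theorem nine (H : OCH B i n c h) (hD : ¬ Done G) (hn : 5 ≤ n) : 9 ≤ n := by
  by_contra h9
  have : Nat.Coprime 3 n := by
    have := H.odd
    have : n = 5 ∨ n = 7 := by omega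
    rcases this with rfl | rfl <;> decide
  obtain ⟨k, hk⟩ := H.dist 3 this
  have := H.d3 hD hn k
  omega

theorem cyc578 (H : OCH B i n c h) (hD : ¬ Done G) (hn : 5 ≤ n) :
    HasCycleLength G (2 * h + 5) ∧ HasCycleLength G (2 * h + 7) ∧ HasCycleLength G (2 * h + 8) := by
  have h9 := H.nine hD hn
  have key : ∀ k d, B.g (c k) (c (k + d)) = h → B.g (c k) (c (k + (d + 3))) = h := by
    intro k d hk
    have h1 := H.d3 hD hn (k + d)
    have h2 := H.ul k (k + d + 3) (k + d)
    have h3 := H.hle k (k + d + 3)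
    rw [B.g_symm (c (k + d + 3))] at h2
    rw [show k + (d + 3) = k + d + 3 by omega]
    omega
  obtain ⟨k, hk⟩ := H.dist 2 (H.cop 2 (by simp))
  obtain ⟨k', hk'⟩ := H.dist 4 (H.cop 4 (by simp))
  exact ⟨H.cyc (key _ _ hk) (by omega) (by omega), H.cyc (key _ _ hk') (by omega) (by omega),
    H.cyc (key _ _ (key _ _ hk)) (by omega) (by omega)⟩

/-- Lemma P -/
theorem lemP (H : OCH B i n c h) (hD : ¬ Done G) (hn : 5 ≤ n) :
    ∃ k, ∀ y ∈ B.L i, G.Adj (c (k + 2)) y → y = c (k + 1) ∨ y = c (k + 3) := by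
  obtain ⟨k, hk⟩ := H.dist 4 (H.cop 4 (by simp))
  refine ⟨k, fun y hy hadj => ?_⟩
  by_contra hne
  push Not at hne
  have e01 : G.Adj (c k) (c (k+1)) := H.adj k
  have e12 : G.Adj (c (k+1)) (c (k+2)) := H.adj (k+1)
  have e23 : G.Adj (c (k+2)) (c (k+3)) := H.adj (k+2)
  have e34 : G.Adj (c (k+3)) (c (k+4)) := H.adj (k+3)
  have e45 : G.Adj (c (k+4)) (c (k+5)) := H.adj (k+4)
  have m0 := H.mem k
  have m1 := H.mem (k+1)
  have m2 := H.mem (k+2)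
  have m3 := H.mem (k+3)
  have m4 := H.mem (k+4)
  have m5 := H.mem (k+5)
  have g03 := H.d3 hD hn k
  have g14 : B.g (c (k+1)) (c (k+4)) < h := H.d3 hD hn (k+1)
  have u1 := H.ul k (k+3) (k+4)
  have u2 := H.ul (k+3) (k+1) (k+4)
  have l13 := H.hle (k+3) (k+1)
  have g13 : B.g (c (k+3)) (c (k+1)) = h := by omega
  have n13 : c (k+1) ≠ c (k+3) := H.ne_of (by omega) (by omega)
  have n14 : c (k+1) ≠ c (k+4) := H.ne_of (by omega) (by omega)
  have n03 : c k ≠ c (k+3) := H.ne_of (by omega) (by omega)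
  have n04 : c k ≠ c (k+4) := H.ne_of (by omega) (by omega)
  have n02 : c k ≠ c (k+2) := H.ne_of (by omega) (by omega)
  have n24 : c (k+2) ≠ c (k+4) := H.ne_of (by omega) (by omega)
  have n25 : c (k+2) ≠ c (k+5) := H.ne_of (by omega) (by have := H.nine hD hn; omega)
  have n35 : c (k+3) ≠ c (k+5) := H.ne_of (by omega) (by omega)
  by_cases y4 : y = c (k+4)
  · subst y4
    exact H.no3 hD hn (B.cl i [c (k+4), c (k+2), c (k+1)] (c (k+3)) (c (k+1)) g13 n13.symm)
  by_cases y0 : y = c k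
  · subst y0
    exact H.no3 hD hn (B.cl i [c k, c (k+2), c (k+3)] (c (k+1)) (c (k+3)) (by rw [B.g_symm, g13]) n13)
  have hul : ∀ a b, B.g y (c a) ≤ max (B.g y (c b)) h := by
    intro a b
    have := B.ultra (u := y) (v := c b) (w := c a) (hy.trans (H.mem _).symm) ((H.mem _).trans (H.mem _).symm)
    have := H.hle b a
    omega
  have hu4 := B.ultra (u := c k) (v := y) (w := c (k+4)) ((H.mem _).trans hy.symm) (hy.trans (H.mem _).symm)
  rw [hk, B.g_symm (c k) y] at hu4
  have q4 := B.cl i [c (k+2), c (k+3), c (k+4)] y (c (k+4)) rfl y4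
  have q0 := B.cl i [c (k+2), c (k+1), c k] y (c k) rfl y0
  by_cases hbig : h < B.g y (c 0)
  · exfalso
    have hall : ∀ a, B.g y (c a) = B.g y (c 0) := by
      intro a
      have := hul a 0
      have := hul 0 a
      omega
    have y5 : y ≠ c (k+5) := by
      intro e
      have h1 := hall (k+5)
      rw [e, B.g_self] at h1
      rw [e] at hbig
      omega
    have q1 := B.cl i [c (k+2)] y (c (k+2)) (hall _) hadj.ne'
    have q2 := B.cl i [c (k+2), c (k+3)] y (c (k+3)) (hall _) hne.2
    have q5 := B.cl i [c (k+2), c (k+3), c (k+4), c (k+5)] y (c (k+5)) (hall _) y5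
    rw [hall] at q4
    exact nd4 hD _ (by simp) q1 q2 q4 q5
  · have hall : ∀ a, B.g y (c a) ≤ h := fun a => by have := hul a 0; omega
    rcases le_max_iff.mp hu4 with h1 | h1
    · rw [le_antisymm (hall k) h1] at q0; exact H.no3 hD hn q0
    · rw [le_antisymm (hall _) h1] at q4; exact H.no3 hD hn q4

end OCH
end FC

namespace FC
open SimpleGraph

variable {V : Type*} {G : SimpleGraph V}

theorem BFS.iso (B : BFS G) {i : ℕ} {a b c : V} (ha : a ∈ B.L i) (hb : b ∈ B.L i) (hc : c ∈ B.L i)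
    (h : B.g a b < B.g b c) : B.g a c = B.g b c := by
  have h1 := B.ultra (u := a) (v := b) (w := c) (ha.trans hb.symm) (hb.trans hc.symm)
  have h2 := B.ultra (u := b) (v := a) (w := c) (hb.trans ha.symm) (ha.trans hc.symm)
  rw [B.g_symm b a] at h2
  omega

/-- gadget at a vertex `z` of an odd cycle in a layer -/
structure Gad (B : BFS G) (i h : ℕ) (z m : V) : Prop where
  hz : z ∈ B.L i
  hm : m ∈ B.L i
  zm : B.g z m < h
  zm' : m = z ∨ G.Adj z m
  c1 : HasCycleLength G (2 * h + 1)
  c2 : HasCycleLength G (2 * h + 2)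
  y : ∃ y1 ∈ B.L i, ∃ y2 ∈ B.L i, G.Adj z y1 ∧ G.Adj y1 y2 ∧ y2 ≠ z ∧ B.g z y1 ≤ h ∧ B.g z y2 ≤ h
  A : ∀ b, b = z ∨ b = m → ∃ p ∈ B.L i, G.Adj p b ∧ B.g z p = h
  Q : ∀ b, b = z ∨ b = m → ∃ q ∈ B.L i, ∃ p ∈ B.L i, G.Adj p q ∧ G.Adj q b ∧ p ≠ b ∧ B.g z p = h ∧
    (B.g z q = h ∨ q = z ∨ q = m)

theorem OCH.d3' {B : BFS G} {i n h : ℕ} {c : ℕ → V} (H : OCH B i n c h) (hD : ¬ Done G) (k : ℕ) :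
    B.g (c k) (c (k + 3)) < h := by
  by_cases hn : 5 ≤ n
  · exact H.d3 hD hn k
  · have : n = 3 := by have := H.three; have := H.odd; omega
    subst this
    rw [H.per, B.g_self]; exact H.hpos

theorem OCH.gad2 {B : BFS G} {i n h : ℕ} {c : ℕ → V} (H : OCH B i n c h) (hD : ¬ Done G) (k : ℕ) :
    ∃ m, Gad B i h (c (k + 2)) m := by
  have hn := H.three
  have e01 : G.Adj (c k) (c (k+1)) := H.adj k
  have e12 : G.Adj (c (k+1)) (c (k+2)) := H.adj (k+1)
  have e23 : G.Adj (c (k+2)) (c (k+3)) := H.adj (k+2)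
  have e34 : G.Adj (c (k+3)) (c (k+4)) := H.adj (k+3)
  have m0 := H.mem k
  have m1 := H.mem (k+1)
  have m2 := H.mem (k+2)
  have m3 := H.mem (k+3)
  have m4 := H.mem (k+4)
  have g03 := H.d3' hD k
  have g14 : B.g (c (k+1)) (c (k+4)) < h := H.d3' hD (k+1)
  have n13 : c (k+1) ≠ c (k+3) := H.ne_of (by omega) (by omega)
  have n02 : c k ≠ c (k+2) := H.ne_of (by omega) (by omega)
  have n24 : c (k+2) ≠ c (k+4) := H.ne_of (by omega) (by omega)
  have hy : ∃ y1 ∈ B.L i, ∃ y2 ∈ B.L i, G.Adj (c (k+2)) y1 ∧ G.Adj y1 y2 ∧ y2 ≠ (c (k+2)) ∧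
    B.g (c (k+2)) y1 ≤ h ∧ B.g (c (k+2)) y2 ≤ h :=
    ⟨_, m3, _, m4, e23, e34, n24.symm, H.hle _ _, H.hle _ _⟩
  have u1 := H.ul (k+2) (k+4) (k+1)
  rw [B.g_symm (c (k+4))] at u1
  have u1' := H.ul (k+2) (k+1) (k+4)
  have u3 := H.ul (k+2) k (k+3)
  have l0 := H.hle (k+2) k
  have l1 := H.hle (k+2) (k+1)
  have l3 := H.hle (k+2) (k+3)
  have l4 := H.hle (k+2) (k+4)
  have no : ¬ (B.g (c (k+2)) (c (k+1)) < h ∧ B.g (c (k+2)) (c (k+3)) < h) := by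
    rintro ⟨h1, h3⟩
    have hall : ∀ t, B.g (c (k+2)) (c (k+2+t)) < h ∧ B.g (c (k+2)) (c (k+2+t+1)) < h ∧
        B.g (c (k+2)) (c (k+2+t+2)) < h := by
      intro t
      induction t with
      | zero => refine ⟨by rw [add_zero, B.g_self]; exact H.hpos, h3, ?_⟩
                show B.g (c (k+2)) (c (k+4)) < h
                omega
      | succ t ih =>
        refine ⟨ih.2.1, ih.2.2, ?_⟩
        have w1 := H.ul (k+2) (k+2+t) (k+2+(t+1)+2)
        have w2 : B.g (c (k+2+t)) (c (k+2+(t+1)+2)) < h := H.d3' hD (k+2+t)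
        have := ih.1
        omega
    obtain ⟨a, b, hab⟩ := H.hex
    have hk : ∀ a, B.g (c (k+2)) (c a) < h := by
      intro a
      have := (hall (a + n * (k+2) - (k+2))).1
      have h2 : k + 2 ≤ n * (k+2) := Nat.le_mul_of_pos_left _ (by omega)
      rwa [show k + 2 + (a + n * (k+2) - (k+2)) = a + n * (k+2) by omega, H.per_mul] at this
    have := H.ul a (k+2) b
    have w1 := hk a
    have w2 := hk b
    rw [B.g_symm (c a) (c (k+2))] at this
    omega
  by_cases h1 : B.g (c (k+2)) (c (k+1)) < h
  · have h3 : B.g (c (k+2)) (c (k+3)) = h := by by_contra hh; exact no ⟨h1, by omega⟩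
    have h0 : B.g (c (k+2)) (c k) = h := by omega
    refine ⟨c (k+1), m2, m1, h1, Or.inr e12.symm, H.cyc1, H.cyc2, hy, ?_, ?_⟩
    · rintro b (rfl | rfl)
      · exact ⟨_, m3, e23.symm, h3⟩
      · exact ⟨_, m0, e01, h0⟩
    · rintro b (rfl | rfl)
      · exact ⟨_, m1, _, m0, e01, e12, n02, h0, by simp⟩
      · exact ⟨_, m2, _, m3, e23.symm, e12.symm, n13.symm, h3, by simp⟩
  by_cases h3 : B.g (c (k+2)) (c (k+3)) < h
  · have h1 : B.g (c (k+2)) (c (k+1)) = h := by by_contra hh; exact no ⟨by omega, h3⟩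
    have h4 : B.g (c (k+2)) (c (k+4)) = h := by omega
    refine ⟨c (k+3), m2, m3, h3, Or.inr e23, H.cyc1, H.cyc2, hy, ?_, ?_⟩
    · rintro b (rfl | rfl)
      · exact ⟨_, m1, e12, h1⟩
      · exact ⟨_, m4, e34.symm, h4⟩
    · rintro b (rfl | rfl)
      · exact ⟨_, m3, _, m4, e34.symm, e23.symm, n24.symm, h4, by simp⟩
      · exact ⟨_, m2, _, m1, e12, e23, n13, h1, by simp⟩
  · have h1 : B.g (c (k+2)) (c (k+1)) = h := by omega
    have h3 : B.g (c (k+2)) (c (k+3)) = h := by omega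
    have h4 : B.g (c (k+2)) (c (k+4)) = h := by omega
    refine ⟨c (k+2), m2, m2, by rw [B.g_self]; exact H.hpos, Or.inl rfl, H.cyc1, H.cyc2, hy, ?_, ?_⟩
    · rintro b (rfl | rfl) <;> exact ⟨_, m1, e12, h1⟩
    · rintro b (rfl | rfl) <;> exact ⟨_, m3, _, m4, e34.symm, e23.symm, n24.symm, h4, Or.inl h3⟩

theorem OCH.gad {B : BFS G} {i n h : ℕ} {c : ℕ → V} (H : OCH B i n c h) (hD : ¬ Done G) (t : ℕ) :
    ∃ m, Gad B i h (c t) m := by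
  have := H.gad2 hD (t + n - 2)
  have hn := H.three
  rwa [show t + n - 2 + 2 = t + n by omega, H.per] at this

namespace Gad
variable {B : BFS G} {i h : ℕ} {z m : V}

theorem c0 (D : Gad B i h z m) {u' w' w : V} {l : ℕ} (hz : G.Adj u' z)
    (hQ : Pth G (B.L (i+1)) u' w' l) (hw' : G.Adj w' w) (hw : w ∈ B.L i) (hne : w ≠ z) :
    HasCycleLength G (2 * B.g z w + 2 + l) :=
  B.conf (Pth.nil ⟨D.hz, by simpa using hne.symm⟩) hz hQ hw' hw

theorem big (D : Gad B i h z m) {u' w' w : V} {l : ℕ} (j : ℕ) (hj : j ≤ 2) (hz : G.Adj u' z)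
    (hQ : Pth G (B.L (i+1)) u' w' l) (hw' : G.Adj w' w) (hw : w ∈ B.L i) (hh : h < B.g z w) :
    HasCycleLength G (2 * B.g z w + 2 + (l + j)) := by
  obtain ⟨y1, m1, y2, m2, a1, a2, hne, g1, g2⟩ := D.y
  have z0 := D.hz
  have n0 : z ≠ w := by rintro rfl; rw [B.g_self] at hh; omega
  have n1 : y1 ≠ w := by rintro rfl; omega
  have n2 : y2 ≠ w := by rintro rfl; omega
  interval_cases j
  · exact D.c0 hz hQ hw' hw n0.symm
  · have := B.conf (pth_list (G := G) (S := B.L i \ {w}) [z] y1 z) hz hQ hw' hw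
    rwa [B.iso m1 z0 hw (by rw [B.g_symm]; omega)] at this
  · have := B.conf (pth_list (G := G) (S := B.L i \ {w}) [y1, z] y2 z) hz hQ hw' hw
    rwa [B.iso m2 z0 hw (by rw [B.g_symm]; omega)] at this

theorem j1 (D : Gad B i h z m) {b u' w' w : V} {l : ℕ} (hb : b = z ∨ b = m) (hz : G.Adj u' b)
    (hQ : Pth G (B.L (i+1)) u' w' l) (hw' : G.Adj w' w) (hw : w ∈ B.L i) (hne : w ≠ b)
    (hh : B.g z w < h) : HasCycleLength G (2 * h + 2 + (l + 1)) := by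
  obtain ⟨p, hp, hadj, hg⟩ := D.A b hb
  have hbL : b ∈ B.L i := by rcases hb with rfl | rfl; exacts [D.hz, D.hm]
  have n1 : p ≠ w := by rintro rfl; omega
  have := B.conf (pth_list (G := G) (S := B.L i \ {w}) [b] p b) hz hQ hw' hw
  rwa [B.g_symm, B.iso hw D.hz hp (by rw [B.g_symm, hg]; exact hh), hg] at this

theorem j2 (D : Gad B i h z m) {b u' w' w : V} {l : ℕ} (hb : b = z ∨ b = m) (hz : G.Adj u' b)
    (hQ : Pth G (B.L (i+1)) u' w' l) (hw' : G.Adj w' w) (hw : w ∈ B.L i) (hne : w ≠ z) (hne' : w ≠ m)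
    (hh : B.g z w < h) : HasCycleLength G (2 * h + 2 + (l + 2)) := by
  obtain ⟨q, hq, p, hp, a1, a2, hpb, hg, hgq⟩ := D.Q b hb
  have hbL : b ∈ B.L i := by rcases hb with rfl | rfl; exacts [D.hz, D.hm]
  have n1 : p ≠ w := by rintro rfl; omega
  have n2 : q ≠ w := by rintro rfl; rcases hgq with h' | h' | h'; exacts [by omega, hne h', hne' h']
  have n3 : b ≠ w := by rintro rfl; rcases hb with h' | h'; exacts [hne h', hne' h']
  have := B.conf (pth_list (G := G) (S := B.L i \ {w}) [q, b] p b) hz hQ hw' hw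
  rwa [B.g_symm, B.iso hw D.hz hp (by rw [B.g_symm, hg]; exact hh), hg] at this

/-- Claim T -/
theorem claimT (D : Gad B i h z m) (hD : ¬ Done G) {u a b w : V} (hu : u ∈ B.L (i+1)) (ha : a ∈ B.L (i+1))
    (hb : b ∈ B.L (i+1)) (hua : G.Adj u a) (hub : G.Adj u b) (hab : G.Adj a b) (hz : G.Adj u z)
    (haw : G.Adj a w) (hw : w ∈ B.L i) : B.g z w < h := by
  by_contra hh
  have hne : w ≠ z := by rintro rfl; rw [B.g_self] at hh; have := D.zm; omega
  have P1 : Pth G (B.L (i+1)) u a 1 := pth_list [a] u a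
  have P2 : Pth G (B.L (i+1)) u a 2 := pth_list [b, a] u a
  rcases eq_or_lt_of_le (not_lt.mp hh) with e | hlt
  · have q1 := D.c0 hz P1 haw hw hne
    have q2 := D.c0 hz P2 haw hw hne
    rw [← e] at q1 q2
    exact nd4 hD _ (by omega) D.c1 D.c2 q1 q2
  · exact nd4 hD (2 * B.g z w + 2 + (1 + 0)) (by omega) (D.big 0 (by omega) hz P1 haw hw hlt)
      (D.big 1 (by omega) hz P1 haw hw hlt) (D.big 2 (by omega) hz P1 haw hw hlt)
      (D.big 2 (by omega) hz P2 haw hw hlt)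

end Gad
end FC

namespace FC
open SimpleGraph

variable {V : Type*} {G : SimpleGraph V}

theorem BFS.g_le (B : BFS G) {i : ℕ} {a b : V} (ha : a ∈ B.L i) (hb : b ∈ B.L i) : B.g a b ≤ i := by
  rw [B.mem_L] at ha hb
  rw [← B.g_iff (by omega)]
  apply B.root
  · have := B.lev_iter i a (by omega); omega
  · have := B.lev_iter i b (by omega); omega

theorem cop124 {n d : ℕ} (hn : n % 2 = 1) (hd : d = 1 ∨ d = 2 ∨ d = 4) : Nat.Coprime d n := by
  have h2 : Nat.Coprime 2 n := by
    rw [Nat.coprime_two_left, Nat.odd_iff]; exact hn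
  rcases hd with rfl | rfl | rfl
  · simp
  · exact h2
  · exact Nat.Coprime.mul_left h2 h2

/-- no long odd cycle below a gadget vertex -/
theorem Gad.noLong {B : BFS G} {i h : ℕ} {z m : V} (D : Gad B i h z m) (hD : ¬ Done G) {n : ℕ} {c : ℕ → V}
    (C : OC G (B.L (i+1)) n c) (hn : 5 ≤ n) (hu : G.Adj (c 0) z) : False := by
  have hz := D.hz
  have hm := D.hm
  have hpath := fun k d hd => C.pth k d hd
  by_cases hO : ∃ r, ∃ k w, c k ≠ c 0 ∧ w ∈ B.L i ∧ G.Adj (c k) w ∧ w ≠ z ∧ w ≠ m ∧ B.g z w = r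
  swap
  · push Not at hO
    have hY : ∀ k, ¬ G.Adj (c k) z → G.Adj (c k) m := by
      intro k hk
      obtain ⟨w, hw, hadj⟩ := B.exists_par (C.mem k)
      by_cases h0 : c k = c 0
      · rw [h0] at hk; exact absurd hu hk
      · by_cases h1 : w = z
        · subst h1; exact absurd hadj hk
        · by_cases h2 : w = m
          · subst h2; exact hadj
          · exact absurd rfl (hO _ k w h0 hw hadj h1 h2)
    have key : ∀ d, 1 ≤ d → d < n → HasCycleLength G (2 + d) := by
      intro d h1 h2
      obtain ⟨k, hk⟩ := lab_same (n := n) d (P := fun k => G.Adj (c k) z) (fun k => by rw [C.per]) C.odd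
      by_cases hh : G.Adj (c k) z
      · exact B.conf0 hh (hpath k d h2) (hk.mp hh) hz h1
      · exact B.conf0 (hY k hh) (hpath k d h2) (hY _ fun h' => hh (hk.mpr h')) hm h1
    exact nd4 hD 3 (by omega) (key 1 (by omega) (by omega)) (key 2 (by omega) (by omega))
      (key 3 (by omega) (by omega)) (key 4 (by omega) (by omega))
  obtain ⟨r, ⟨k0, w0, hk0, hw0, ha0, hz0, hm0, hg0⟩, hmax⟩ := exists_max (b := i) hO (by
    rintro r ⟨k, w, _, hw, _, _, _, rfl⟩
    exact B.g_le hz hw)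
  rcases lt_or_ge r h with hr | hr
  · let P : ℕ → Prop := fun k => ∃ w, c k ≠ c 0 ∧ w ∈ B.L i ∧ G.Adj (c k) w ∧ w ≠ z ∧ w ≠ m
    have hY : ∀ k, ¬ P k → ∃ b, (b = z ∨ b = m) ∧ G.Adj (c k) b := by
      intro k hk
      by_cases h0 : c k = c 0
      · exact ⟨z, Or.inl rfl, h0 ▸ hu⟩
      · obtain ⟨w, hw, hadj⟩ := B.exists_par (C.mem k)
        by_contra hcon
        push Not at hcon
        exact hk ⟨w, h0, hw, hadj, fun e => hcon _ (Or.inl e) hadj, fun e => hcon _ (Or.inr e) hadj⟩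
    have key : ∀ d, d = 1 ∨ d = 2 ∨ d = 4 → HasCycleLength G (2 * h + 2 + (d + 1)) ∧
        HasCycleLength G (2 * h + 2 + (d + 2)) := by
      intro d hd
      obtain ⟨k, h1, h2⟩ := lab_ex (n := n) (d := d) (P := fun k => ¬ P k) (a := 0) (b := k0)
        (fun k => by simp only [P, C.per]) (cop124 C.odd hd) (by omega) (by simp [P])
        (not_not.mpr ⟨w0, hk0, hw0, ha0, hz0, hm0⟩)
      obtain ⟨b, hb, hadj⟩ := hY k h1
      obtain ⟨w, hk', hw, ha, hz', hm'⟩ := not_not.mp h2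
      have hlt : B.g z w < h := by have := hmax _ ⟨_, w, hk', hw, ha, hz', hm', rfl⟩; omega
      refine ⟨D.j1 hb hadj (hpath k d (by omega)) ha hw ?_ hlt,
        D.j2 hb hadj (hpath k d (by omega)) ha hw hz' hm' hlt⟩
      rcases hb with rfl | rfl <;> assumption
    have k2 := key 2 (by omega)
    have k4 := key 4 (by omega)
    exact nd4 hD (2 * h + 2 + (2 + 1)) (by omega) k2.1 k2.2 k4.1 k4.2
  · let P : ℕ → Prop := fun k => ∃ w, c k ≠ c 0 ∧ w ∈ B.L i ∧ G.Adj (c k) w ∧ B.g z w = r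
    have hP0 : P k0 := ⟨w0, hk0, hw0, ha0, hg0⟩
    have hY : ∀ k, ¬ P k → ∃ b, b ∈ B.L i ∧ G.Adj (c k) b ∧ B.g z b < r := by
      intro k hk
      have := D.zm
      by_cases h0 : c k = c 0
      · exact ⟨z, hz, h0 ▸ hu, by rw [B.g_self]; omega⟩
      · obtain ⟨w, hw, hadj⟩ := B.exists_par (C.mem k)
        refine ⟨w, hw, hadj, ?_⟩
        by_cases h1 : w = z
        · rw [h1, B.g_self]; omega
        by_cases h2 : w = m
        · rw [h2]; omega
        have h3 := hmax _ ⟨k, w, h0, hw, hadj, h1, h2, rfl⟩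
        have h4 : B.g z w ≠ r := fun e => hk ⟨w, h0, hw, hadj, e⟩
        omega
    have key0 : ∀ k d, ¬ P k → P (k + d) → d < n → HasCycleLength G (2 * r + 2 + d) := by
      intro k d h1 h2 hd
      obtain ⟨b, hb, hadj, hlt⟩ := hY k h1
      obtain ⟨w, hk', hw, ha, hg⟩ := h2
      have hg' : B.g b w = r := by rw [B.iso hb hz hw (by rw [B.g_symm]; omega), hg]
      have hne : b ≠ w := by rintro rfl; omega
      have := B.conf (Pth.nil (G := G) (S := B.L i \ {w}) ⟨hb, by simpa using hne⟩) hadj (hpath k d hd) ha hw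
      rwa [hg'] at this
    have hn0 : ¬ P 0 := by simp [P]
    have key : ∀ d, d = 1 ∨ d = 2 ∨ d = 4 → HasCycleLength G (2 * r + 2 + d) := by
      intro d hd
      obtain ⟨k, h1, h2⟩ := lab_ex (n := n) (d := d) (P := fun k => ¬ P k) (a := 0) (b := k0)
        (fun k => by simp only [P, C.per]) (cop124 C.odd hd) (by omega) hn0
        (not_not.mpr hP0)
      exact key0 k d h1 (not_not.mp h2) (by omega)
    rcases eq_or_lt_of_le hr with e | hlt
    · subst e
      exact nd4 hD _ (by omega) D.c1 D.c2 (key 1 (by omega)) (key 2 (by omega))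
    · have h3 : HasCycleLength G (2 * r + 2 + 3) := by
        classical
        have hex : ∃ t, P t := ⟨k0, hP0⟩
        obtain ⟨t, ht, hmin⟩ : ∃ t, P t ∧ ∀ s < t, ¬ P s :=
          ⟨Nat.find hex, Nat.find_spec hex, fun s hs => Nat.find_min hex hs⟩
        have ht0 : t ≠ 0 := by rintro rfl; exact hn0 ht
        by_cases h4 : 4 ≤ t
        · exact key0 (t - 3) 3 (hmin _ (by omega)) (by rwa [show t - 3 + 3 = t by omega]) (by omega)
        · obtain ⟨w, hk', hw, ha, hg⟩ := ht
          have := D.big (3 - t) (by omega) hu (hpath 0 t (by omega)) (by rwa [zero_add]) hw (by omega)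
          rw [hg] at this
          exact cyc_congr this (by omega)
      exact nd4 hD _ (by omega) (key 1 (by omega)) (key 2 (by omega)) h3 (key 4 (by omega))

end FC

namespace FC
open SimpleGraph

variable {V : Type*} {G : SimpleGraph V}

theorem BFS.nl (B : BFS G) {i : ℕ} {a b : V} (ha : a ∈ B.L i) (hb : b ∈ B.L (i+1)) : a ≠ b := by
  rintro rfl
  rw [B.mem_L] at ha hb; omega

theorem BFS.edge (B : BFS G) {i h : ℕ} {a b w w' : V} (ha : a ∈ B.L (i+1)) (hb : b ∈ B.L (i+1))
    (hab : G.Adj a b) (hw : w ∈ B.L i) (hw' : w' ∈ B.L i) (haw : G.Adj a w) (hbw : G.Adj b w')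
    (hg : B.g w w' = h) (hh : 0 < h) : HasCycleLength G (2 * h + 3) := by
  have hne : w ≠ w' := by rintro rfl; rw [B.g_self] at hg; omega
  have := B.conf (Pth.nil (G := G) (S := B.L i \ {w'}) ⟨hw, by simpa using hne⟩) haw
    (pth_list (S := B.L (i+1)) [b] a b) hbw hw'
  rw [hg] at this
  exact this

theorem D1e {B : BFS G} {i : ℕ} (hD : ¬ Done G) {z1 e q z2 d u1 u2 u3 : V}
    (hz1 : z1 ∈ B.L i) (he : e ∈ B.L i) (hq : q ∈ B.L i) (hz2 : z2 ∈ B.L i) (hd : d ∈ B.L i)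
    (h1 : u1 ∈ B.L (i+1)) (h2 : u2 ∈ B.L (i+1)) (h3 : u3 ∈ B.L (i+1))
    (a12 : G.Adj u1 u2) (a13 : G.Adj u1 u3) (a23 : G.Adj u2 u3) (b1 : G.Adj u1 z1) (b2 : G.Adj u2 z2)
    (hne : z1 ≠ z2) (hna : ¬ G.Adj z1 z2)
    (c1 : G.Adj z1 e) (c2 : G.Adj z1 q) (c3 : G.Adj e q) (d1 : G.Adj z2 e) (d2 : G.Adj z2 d)
    (d3 : G.Adj e d) : False := by
  have l := @BFS.nl V G B i
  have x1 := l hz1 h1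
  have x2 := l hz1 h2
  have x3 := l hz1 h3
  have x4 := l hz2 h1
  have x5 := l hz2 h2
  have x6 := l hz2 h3
  have x7 := l he h1
  have x8 := l he h2
  have x9 := l he h3
  have y1 := l hq h1
  have y2 := l hq h2
  have y3 := l hq h3
  have y4 := l hd h1
  have y5 := l hd h2
  have y6 := l hd h3
  clear l
  have n1 : q ≠ z2 := by rintro rfl; exact hna c2
  have n2 : d ≠ z1 := by rintro rfl; exact hna d2.symm
  have k5 : HasCycleLength G 5 := cyc_list [z1, u1, u2, z2] e
  have k6 : HasCycleLength G 6 := cyc_list [z1, u1, u3, u2, z2] e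
  by_cases hqd : q = d
  · subst hqd
    exact nd4 hD 3 (by omega) (cyc_list [e, q] z1) (cyc_list [e, z2, q] z1) k5 k6
  · exact nd4 hD 5 (by omega) k5 k6 (cyc_list [q, z1, u1, u3, u2, z2] e) (cyc_list [q, z1, u1, u3, u2, z2, d] e)

theorem D1t {B : BFS G} {i : ℕ} (hD : ¬ Done G) {z1 p q z2 c d u1 u2 u3 : V}
    (hz1 : z1 ∈ B.L i) (hp : p ∈ B.L i) (hq : q ∈ B.L i) (hz2 : z2 ∈ B.L i) (hc : c ∈ B.L i) (hd : d ∈ B.L i)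
    (h1 : u1 ∈ B.L (i+1)) (h2 : u2 ∈ B.L (i+1)) (h3 : u3 ∈ B.L (i+1))
    (a12 : G.Adj u1 u2) (a13 : G.Adj u1 u3) (a23 : G.Adj u2 u3) (b1 : G.Adj u1 z1) (b2 : G.Adj u2 z2)
    (hne : z1 ≠ z2) (hna : ¬ G.Adj z1 z2)
    (c1 : G.Adj z1 p) (c2 : G.Adj z1 q) (c3 : G.Adj p q) (d1 : G.Adj z2 c) (d2 : G.Adj z2 d)
    (d3 : G.Adj c d) : False := by
  by_cases e1 : p = c
  · subst e1; exact D1e hD hz1 hp hq hz2 hd h1 h2 h3 a12 a13 a23 b1 b2 hne hna c1 c2 c3 d1 d2 d3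
  by_cases e2 : p = d
  · subst e2; exact D1e hD hz1 hp hq hz2 hc h1 h2 h3 a12 a13 a23 b1 b2 hne hna c1 c2 c3 d2 d1 d3.symm
  by_cases e3 : q = c
  · subst e3; exact D1e hD hz1 hq hp hz2 hd h1 h2 h3 a12 a13 a23 b1 b2 hne hna c2 c1 c3.symm d1 d2 d3
  by_cases e4 : q = d
  · subst e4; exact D1e hD hz1 hq hp hz2 hc h1 h2 h3 a12 a13 a23 b1 b2 hne hna c2 c1 c3.symm d2 d1 d3.symm
  have n1 : q ≠ z2 := by rintro rfl; exact hna c2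
  have n2 : d ≠ z1 := by rintro rfl; exact hna d2.symm
  have n3 : p ≠ z2 := by rintro rfl; exact hna c1
  have n4 : c ≠ z1 := by rintro rfl; exact hna d1.symm
  have P1 : Pth G (B.L i \ {c}) p z1 1 := pth_list [z1] p z1
  have P2 : Pth G (B.L i \ {c}) p z1 2 := pth_list [q, z1] p z1
  -- the low part of the path
  have key : ∀ S : Set V, ∀ j l k, Pth G S p z1 j → S ⊆ {p, q, z1} → Pth G (B.L (i+1)) u1 u2 l →
      Pth G {z2, d, c} z2 c k → HasCycleLength G (2 * B.g p c + (j + 1 + l + 1 + k)) := by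
    intro S j l k hP hS hQ hR
    have hS' : S ⊆ B.L i := fun x hx => by
      rcases hS hx with rfl | rfl | rfl <;> assumption
    have q1 := hP.link b1.symm hQ (by
      rw [Set.disjoint_left]; intro x hx hx'
      exact B.nl (hS' hx) hx' rfl)
    have q2 := q1.link b2 hR (by
      rw [Set.disjoint_left]
      rintro x (hx | hx) hx'
      · have := hS hx
        simp only [Set.mem_insert_iff, Set.mem_singleton_iff] at this hx'
        grind
      · have : x ∈ B.L i := by rcases hx' with rfl | rfl | rfl <;> assumption
        exact B.nl this hx rfl)
    refine B.close (i := i) (q2.mono ?_) hp hc e1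
    rintro x ((hx | hx) | hx)
    · exact (hS' hx).ge
    · have : B.lev x = i + 1 := hx
      simp; omega
    · have : x ∈ B.L i := by rcases hx with rfl | rfl | rfl <;> assumption
      exact this.ge
  have A1 : Pth G {p, z1} p z1 1 := pth_list [z1] p z1
  have A2 : Pth G {p, q, z1} p z1 2 := pth_list [q, z1] p z1
  have B1 : Pth G (B.L (i+1)) u1 u2 1 := pth_list [u2] u1 u2
  have B2 : Pth G (B.L (i+1)) u1 u2 2 := pth_list [u3, u2] u1 u2
  have C1 : Pth G {z2, d, c} z2 c 1 := pth_list [c] z2 c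
  have C2 : Pth G {z2, d, c} z2 c 2 := pth_list [d, c] z2 c
  have s1 : ({p, z1} : Set V) ⊆ {p, q, z1} := by intro x; simp; tauto
  exact nd4 hD (2 * B.g p c + 5) (by omega) (key _ 1 1 1 A1 s1 B1 C1) (key _ 1 2 1 A1 s1 B2 C1)
    (key _ 2 2 1 A2 subset_rfl B2 C1) (key _ 2 2 2 A2 subset_rfl B2 C2)

theorem D1long {B : BFS G} {i : ℕ} (hD : ¬ Done G) {z2 u1 u2 u3 : V} {n : ℕ} {c : ℕ → V}
    (C : OC G (B.L i) n c) (hn : 5 ≤ n) (hz2 : z2 ∈ B.L i)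
    (h1 : u1 ∈ B.L (i+1)) (h2 : u2 ∈ B.L (i+1)) (h3 : u3 ∈ B.L (i+1))
    (a12 : G.Adj u1 u2) (a13 : G.Adj u1 u3) (a23 : G.Adj u2 u3) (b1 : G.Adj u1 (c 0)) (b2 : G.Adj u2 z2)
    (hne : c 0 ≠ z2) (hna : ¬ G.Adj (c 0) z2) : False := by
  obtain ⟨h, H⟩ := C.exists_h
  obtain ⟨m, D⟩ := H.gad hD 0
  have hlt := D.claimT hD h1 h2 h3 a12 a13 a23 b1 b2 hz2
  have hm : z2 ≠ m := by
    rintro rfl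
    rcases D.zm' with h' | h'
    · exact hne h'.symm
    · exact hna h'
  have q := D.j2 (Or.inl rfl) b1 (pth_list (S := B.L (i+1)) [u3, u2] u1 u2) b2 hz2 hne.symm hm hlt
  obtain ⟨q5, q7, q8⟩ := H.cyc578 hD hn
  exact nd4 hD _ (by omega) q5 q q7 q8

/-- D1 -/
theorem D1 {B : BFS G} {i : ℕ} (hD : ¬ Done G) {u1 u2 u3 : V} {n1 n2 : ℕ} {c1 c2 : ℕ → V}
    (C1 : OC G (B.L i) n1 c1) (C2 : OC G (B.L i) n2 c2)
    (h1 : u1 ∈ B.L (i+1)) (h2 : u2 ∈ B.L (i+1)) (h3 : u3 ∈ B.L (i+1))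
    (a12 : G.Adj u1 u2) (a13 : G.Adj u1 u3) (a23 : G.Adj u2 u3) (b1 : G.Adj u1 (c1 0))
    (b2 : G.Adj u2 (c2 0)) (hne : c1 0 ≠ c2 0) (hna : ¬ G.Adj (c1 0) (c2 0)) : False := by
  by_cases k1 : 5 ≤ n1
  · exact D1long hD C1 k1 (C2.mem 0) h1 h2 h3 a12 a13 a23 b1 b2 hne hna
  by_cases k2 : 5 ≤ n2
  · exact D1long hD C2 k2 (C1.mem 0) h2 h1 h3 a12.symm a23 a13 b2 b1 hne.symm (fun h => hna h.symm)
  have e1 : n1 = 3 := by have := C1.three; have := C1.odd; omega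
  have e2 : n2 = 3 := by have := C2.three; have := C2.odd; omega
  subst e1 e2
  have p1 : c1 3 = c1 0 := C1.per 0
  have p2 : c2 3 = c2 0 := C2.per 0
  have a1 : G.Adj (c1 2) (c1 0) := p1 ▸ C1.adj 2
  have a2 : G.Adj (c2 2) (c2 0) := p2 ▸ C2.adj 2
  exact D1t hD (C1.mem 0) (C1.mem 1) (C1.mem 2) (C2.mem 0) (C2.mem 1) (C2.mem 2) h1 h2 h3 a12 a13 a23 b1 b2
    hne hna (C1.adj 0) a1.symm (C1.adj 1) (C2.adj 0) a2.symm (C2.adj 1)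

end FC

namespace FC
open SimpleGraph

variable {V : Type*} {G : SimpleGraph V}

theorem nd4' (hD : ¬ Done G) (n : ℕ) {a b c d : ℕ} (h0 : HasCycleLength G a) (h1 : HasCycleLength G b)
    (h2 : HasCycleLength G c) (h3 : HasCycleLength G d)
    (e : n % 2 = 1 ∧ a = n ∧ b = n + 1 ∧ c = n + 2 ∧ d = n + 3 := by omega) : False := by
  obtain ⟨e, rfl, rfl, rfl, rfl⟩ := e
  exact nd4 hD _ e h0 h1 h2 h3

namespace Gad
variable {B : BFS G} {i h : ℕ} {z m : V}

theorem hpos (D : Gad B i h z m) : 0 < h := by have := D.zm; omega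

/-- vertex `v` with neighbour `m1`, parents w, w1 with g z w < h = g z w1 -/
theorem edge' (D : Gad B i h z m) {a b w w' : V} (ha : a ∈ B.L (i+1)) (hb : b ∈ B.L (i+1))
    (hab : G.Adj a b) (hw : w ∈ B.L i) (hw' : w' ∈ B.L i) (haw : G.Adj a w) (hbw : G.Adj b w')
    (h1 : B.g z w < B.g z w') : HasCycleLength G (2 * B.g z w' + 3) :=
  B.edge ha hb hab hw hw' haw hbw (B.iso hw D.hz hw' (by rw [B.g_symm]; exact h1)) (by omega)

theorem D2bow (D : Gad B i h z m) (hD : ¬ Done G) {s t v m1 m2 w : V}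
    (hs : s ∈ B.L (i+1)) (ht : t ∈ B.L (i+1)) (hv : v ∈ B.L (i+1)) (hm1 : m1 ∈ B.L (i+1))
    (hm2 : m2 ∈ B.L (i+1)) (hst : G.Adj s t) (hsv : G.Adj s v) (htv : G.Adj t v)
    (sz : G.Adj s z) (tz : G.Adj t z) (hw : w ∈ B.L i) (vw : G.Adj v w) (hwz : w ≠ z)
    (v1 : G.Adj v m1) (v2 : G.Adj v m2) (m12 : G.Adj m1 m2) (n1 : m1 ≠ s) (n2 : m1 ≠ t)
    (n3 : m2 ≠ s) (n4 : m2 ≠ t) : False := by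
  have x0 := D.hz
  have x1 := B.nl D.hz hs
  have x2 := B.nl D.hz ht
  have x3 := B.nl D.hz hv
  have x4 := B.nl D.hz hm1
  have k3 : HasCycleLength G 3 := cyc_list [s, t] z
  have k4 : HasCycleLength G 4 := cyc_list [s, v, t] z
  have gw := D.claimT hD hs hv ht hsv hst htv.symm sz vw hw
  have P2 : Pth G (B.L (i+1)) s m1 2 := pth_list [v, m1] s m1
  have P3 : Pth G (B.L (i+1)) s m1 3 := pth_list [t, v, m1] s m1
  have P4 : Pth G (B.L (i+1)) s m1 4 := pth_list [t, v, m2, m1] s m1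
  obtain ⟨w1, hw1, a1⟩ := B.exists_par hm1
  by_cases e1 : w1 = z
  · subst e1
    exact nd4' hD 3 k3 k4 (B.conf0 sz P3 a1 hw1 (by omega)) (B.conf0 sz P4 a1 hw1 (by omega))
  rcases lt_trichotomy (B.g z w1) h with g1 | g1 | g1
  · by_cases e2 : w1 = m
    · subst e2
      have zm := D.zm'.resolve_left e1
      have y1 := B.nl hw1 hs
      have y2 := B.nl hw1 ht
      have y3 := B.nl hw1 hv
      have y4 := B.nl hw1 hm1
      exact nd4 hD 3 (by omega) k3 k4 (cyc_list [s, v, m1, w1] z) (cyc_list [s, t, v, m1, w1] z) 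
    · exact nd4' hD (2*h+5) (D.j1 (Or.inl rfl) sz P2 a1 hw1 e1 g1) (D.j1 (Or.inl rfl) sz P3 a1 hw1 e1 g1)
        (D.j1 (Or.inl rfl) sz P4 a1 hw1 e1 g1) (D.j2 (Or.inl rfl) sz P4 a1 hw1 e1 e2 g1)
  · exact nd4' hD (2*h+1) D.c1 D.c2 (D.edge' hv hm1 v1 hw hw1 vw a1 (by omega)) (D.c0 sz P2 a1 hw1 e1)
  · exact nd4' hD (2*B.g z w1+5) (D.big 1 (by omega) sz P2 a1 hw1 g1) (D.big 2 (by omega) sz P2 a1 hw1 g1)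
      (D.big 2 (by omega) sz P3 a1 hw1 g1) (D.big 2 (by omega) sz P4 a1 hw1 g1)

theorem D2far (D : Gad B i h z m) (hD : ¬ Done G) {s t v m1 x y w : V}
    (hs : s ∈ B.L (i+1)) (ht : t ∈ B.L (i+1)) (hv : v ∈ B.L (i+1)) (hm1 : m1 ∈ B.L (i+1))
    (hx : x ∈ B.L (i+1)) (hy : y ∈ B.L (i+1)) (hst : G.Adj s t) (hsv : G.Adj s v) (htv : G.Adj t v)
    (sz : G.Adj s z) (tz : G.Adj t z) (hw : w ∈ B.L i) (vw : G.Adj v w) (hwz : w ≠ z)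
    (v1 : G.Adj v m1) (m1x : G.Adj m1 x) (m1y : G.Adj m1 y) (xy : G.Adj x y) (n1 : m1 ≠ s) (n2 : m1 ≠ t)
    (n3 : x ≠ s) (n4 : x ≠ t) (n5 : x ≠ v) (n6 : y ≠ s) (n7 : y ≠ t) (n8 : y ≠ v) : False := by
  have x0 := D.hz
  have x1 := B.nl D.hz hs
  have x2 := B.nl D.hz ht
  have x3 := B.nl D.hz hv
  have k3 : HasCycleLength G 3 := cyc_list [s, t] z
  have k4 : HasCycleLength G 4 := cyc_list [s, v, t] z
  have gw := D.claimT hD hs hv ht hsv hst htv.symm sz vw hw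
  have Q1 : Pth G (B.L (i+1)) s v 1 := pth_list [v] s v
  have Q2 : Pth G (B.L (i+1)) s v 2 := pth_list [t, v] s v
  have R2 : Pth G (B.L (i+1)) s m1 2 := pth_list [v, m1] s m1
  have P3 : Pth G (B.L (i+1)) s x 3 := pth_list [v, m1, x] s x
  have P4 : Pth G (B.L (i+1)) s x 4 := pth_list [t, v, m1, x] s x
  have P5 : Pth G (B.L (i+1)) s x 5 := pth_list [t, v, m1, y, x] s x
  obtain ⟨w1, hw1, a1⟩ := B.exists_par hm1
  obtain ⟨wx, hwx, ax⟩ := B.exists_par hx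
  by_cases e1 : wx = z
  · subst e1
    exact nd4' hD 3 k3 k4 (B.conf0 sz P3 ax hwx (by omega)) (B.conf0 sz P4 ax hwx (by omega))
  rcases lt_trichotomy (B.g z wx) h with g1 | g1 | g1
  · exact nd4' hD (2*h+5) (D.j1 (Or.inl rfl) sz Q2 vw hw hwz gw) (D.j1 (Or.inl rfl) sz P3 ax hwx e1 g1)
      (D.j1 (Or.inl rfl) sz P4 ax hwx e1 g1) (D.j1 (Or.inl rfl) sz P5 ax hwx e1 g1)
  · have q4 := D.j1 (Or.inl rfl) sz Q1 vw hw hwz gw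
    rcases lt_trichotomy (B.g z w1) h with g2 | g2 | g2
    · exact nd4' hD (2*h+1) D.c1 D.c2 (D.edge' hm1 hx m1x hw1 hwx a1 ax (by omega)) q4
    · exact nd4' hD (2*h+1) D.c1 D.c2 (D.edge' hv hm1 v1 hw hw1 vw a1 (by omega)) q4
    · exact nd4' hD (2*B.g z w1+3) (D.edge' hv hm1 v1 hw hw1 vw a1 (by omega)) (D.big 0 (by omega) sz R2 a1 hw1 g2)
        (D.big 1 (by omega) sz R2 a1 hw1 g2) (D.big 2 (by omega) sz R2 a1 hw1 g2)
  · exact nd4' hD (2*B.g z wx+5) (D.big 0 (by omega) sz P3 ax hwx g1) (D.big 1 (by omega) sz P3 ax hwx g1)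
      (D.big 2 (by omega) sz P3 ax hwx g1) (D.big 2 (by omega) sz P4 ax hwx g1)

theorem D3 (D : Gad B i h z m) (hD : ¬ Done G) {c a b v m1 x y : V}
    (hc : c ∈ B.L (i+1)) (ha : a ∈ B.L (i+1)) (hb : b ∈ B.L (i+1)) (hv : v ∈ B.L (i+1)) (hm1 : m1 ∈ B.L (i+1))
    (hx : x ∈ B.L (i+1)) (hy : y ∈ B.L (i+1)) (ca : G.Adj c a) (cb : G.Adj c b) (ab : G.Adj a b)
    (av : G.Adj a v) (bv : G.Adj b v) (cv : c ≠ v) (cz : G.Adj c z) (az : ¬ G.Adj a z)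
    (v1 : G.Adj v m1) (m1x : G.Adj m1 x) (m1y : G.Adj m1 y) (xy : G.Adj x y) (n1 : m1 ≠ a) (n2 : m1 ≠ b)
    (n3 : m1 ≠ c) (xa : x ≠ a) (xb : x ≠ b) (xc : x ≠ c) (ya : y ≠ a) (yb : y ≠ b) (yc : y ≠ c) : False := by
  have x0 := D.hz
  have x1 := B.nl D.hz hc
  have x2 := B.nl D.hz ha
  have x3 := B.nl D.hz hv
  have x4 := B.nl D.hz hx
  have x5 := B.nl D.hz hy
  have x6 := B.nl D.hz hm1
  have k3 : HasCycleLength G 3 := cyc_list [a, b] c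
  have k4 : HasCycleLength G 4 := cyc_list [a, v, b] c
  obtain ⟨wa, hwa, aa⟩ := B.exists_par ha
  obtain ⟨w1, hw1, a1⟩ := B.exists_par hm1
  obtain ⟨wv, hwv, avv⟩ := B.exists_par hv
  have ga := D.claimT hD hc ha hb ca cb ab cz aa hwa
  have eaz : wa ≠ z := by rintro rfl; exact az aa
  have Q1 : Pth G (B.L (i+1)) c a 1 := pth_list [a] c a
  have Q2 : Pth G (B.L (i+1)) c a 2 := pth_list [b, a] c a
  have R2 : Pth G (B.L (i+1)) c v 2 := pth_list [a, v] c v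
  have P3 : Pth G (B.L (i+1)) c m1 3 := pth_list [a, v, m1] c m1
  have P4 : Pth G (B.L (i+1)) c m1 4 := pth_list [a, b, v, m1] c m1
  have q4 := D.j1 (Or.inl rfl) cz Q1 aa hwa eaz ga
  by_cases e1 : w1 = z
  · subst e1
    exact nd4' hD 3 k3 k4 (B.conf0 cz P3 a1 hw1 (by omega)) (B.conf0 cz P4 a1 hw1 (by omega))
  rcases lt_trichotomy (B.g z w1) h with g1 | g1 | g1
  · have r3 := D.j1 (Or.inl rfl) cz Q2 aa hwa eaz ga
    have r4 := D.j1 (Or.inl rfl) cz P3 a1 hw1 e1 g1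
    have r5 := D.j1 (Or.inl rfl) cz P4 a1 hw1 e1 g1
    by_cases e2 : w1 = m
    · subst e2
      have zm := D.zm'.resolve_left e1
      have bow : ∀ m2, m2 ∈ B.L (i+1) → G.Adj m1 m2 → G.Adj m2 v → m2 ≠ a → m2 ≠ b → m2 ≠ c → False := by
        intro m2 k1 k2 k3 k4 k5 k6
        have P5 : Pth G (B.L (i+1)) c m1 5 := pth_list [a, b, v, m2, m1] c m1
        exact nd4' hD (2*h+5) r3 r4 r5 (D.j1 (Or.inl rfl) cz P5 a1 hw1 e1 g1)
      by_cases exv : x = v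
      · subst exv; exact bow y hy m1y xy.symm ya yb yc
      by_cases eyv : y = v
      · subst eyv; exact bow x hx m1x xy xa xb xc
      have P4 : Pth G (B.L (i+1)) c x 4 := pth_list [a, v, m1, x] c x
      have P5 : Pth G (B.L (i+1)) c x 5 := pth_list [a, b, v, m1, x] c x
      have P6 : Pth G (B.L (i+1)) c x 6 := pth_list [a, b, v, m1, y, x] c x
      obtain ⟨wx, hwx, ax⟩ := B.exists_par hx
      have y1 := B.nl hw1 hx
      have y2 := B.nl hw1 hy
      have y3 := B.nl hw1 hm1
      by_cases e3 : wx = z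
      · subst e3
        exact nd4 hD 3 (by omega) k3 k4 (cyc_list [x, y, m1, w1] wx) (cyc_list [c, a, v, m1, x] wx)
      rcases lt_trichotomy (B.g z wx) h with g3 | g3 | g3
      · exact nd4' hD (2*h+5) r3 r4 r5 (D.j1 (Or.inl rfl) cz P5 ax hwx e3 g3)
      · exact nd4' hD (2*h+1) D.c1 D.c2 (D.edge' hm1 hx m1x hw1 hwx a1 ax (by omega)) q4
      · exact nd4' hD (2*B.g z wx+7) (D.big 1 (by omega) cz P4 ax hwx g3) (D.big 2 (by omega) cz P4 ax hwx g3)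
          (D.big 2 (by omega) cz P5 ax hwx g3) (D.big 2 (by omega) cz P6 ax hwx g3)
    · exact nd4' hD (2*h+5) r3 r4 r5 (D.j2 (Or.inl rfl) cz P4 a1 hw1 e1 e2 g1)
  · rcases lt_trichotomy (B.g z wv) h with g2 | g2 | g2
    · exact nd4' hD (2*h+1) D.c1 D.c2 (D.edge' hv hm1 v1 hwv hw1 avv a1 (by omega)) q4
    · exact nd4' hD (2*h+1) D.c1 D.c2 (D.edge' ha hv av hwa hwv aa avv (by omega)) q4
    · exact nd4' hD (2*B.g z wv+3) (D.edge' ha hv av hwa hwv aa avv (by omega)) (D.big 0 (by omega) cz R2 avv hwv g2)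
        (D.big 1 (by omega) cz R2 avv hwv g2) (D.big 2 (by omega) cz R2 avv hwv g2)
  · exact nd4' hD (2*B.g z w1+5) (D.big 0 (by omega) cz P3 a1 hw1 g1) (D.big 1 (by omega) cz P3 a1 hw1 g1)
      (D.big 2 (by omega) cz P3 a1 hw1 g1) (D.big 2 (by omega) cz P4 a1 hw1 g1)

end Gad
end FC

namespace FC
open SimpleGraph

variable {V : Type*} {G : SimpleGraph V}

theorem oc_fn {K : Set V} {n : ℕ} (g : ℕ → V) (hodd : n % 2 = 1) (h3 : 3 ≤ n)
    (hi : ∀ a b, a < b → b < n → g a ≠ g b) (ha : ∀ k, k + 1 < n → G.Adj (g k) (g (k+1)))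
    (hl : G.Adj (g (n-1)) (g 0)) (hm : ∀ k < n, g k ∈ K) : OC G K n (fun k => g (k % n)) where
  odd := hodd
  three := h3
  mem k := hm _ (Nat.mod_lt _ (by omega))
  per k := by simp
  adj k := by
    have hk := Nat.mod_lt k (show n > 0 by omega)
    show G.Adj (g (k % n)) (g ((k+1) % n))
    rw [Nat.add_mod, Nat.mod_eq_of_lt (show 1 < n by omega)]
    by_cases h : k % n + 1 < n
    · rw [Nat.mod_eq_of_lt h]; exact ha _ h
    · have e : k % n = n - 1 := by omega
      rw [e, show n - 1 + 1 = n by omega, Nat.mod_self]; exact hl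
  inj a b ha hb e := by
    rw [Nat.mod_eq_of_lt ha, Nat.mod_eq_of_lt hb] at e
    rcases lt_trichotomy a b with h | h | h
    · exact absurd e (hi _ _ h hb)
    · exact h
    · exact absurd e.symm (hi _ _ h ha)

theorem oc_tri {K : Set V} {a b c : V} (ha : a ∈ K) (hb : b ∈ K) (hc : c ∈ K) (ab : G.Adj a b)
    (bc : G.Adj b c) (ca : G.Adj c a) : OC G K 3 (fun k => (fun j => if j = 0 then a else if j = 1 then b else c) (k % 3)) := by
  refine oc_fn (n := 3) (fun j => if j = 0 then a else if j = 1 then b else c) (by omega) (by omega) ?_ ?_ ?_ ?_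
  · intro x y hxy hy
    have : y = 1 ∨ y = 2 := by omega
    have : x = 0 ∨ x = 1 := by omega
    have := ab.ne
    have := bc.ne
    have := ca.ne.symm
    rcases ‹y = 1 ∨ _› with rfl | rfl <;> rcases ‹x = 0 ∨ _› with rfl | rfl <;> simp_all
  · intro k hk
    have : k = 0 ∨ k = 1 := by omega
    rcases this with rfl | rfl <;> simpa
  · simpa
  · intro k hk
    have : k = 0 ∨ k = 1 ∨ k = 2 := by omega
    rcases this with rfl | rfl | rfl <;> simpa

/-- a path with n vertices -/
structure LP (G : SimpleGraph V) (K : Set V) (n : ℕ) (f : ℕ → V) : Prop where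
  mem : ∀ k < n, f k ∈ K
  adj : ∀ k, k + 1 < n → G.Adj (f k) (f (k+1))
  inj : ∀ a b, a < n → b < n → f a = f b → a = b

/-- hypotheses on K -/
structure TK (G : SimpleGraph V) (K : Set V) (n : ℕ) : Prop where
  oc : ∀ n c, OC G K n c → n = 3
  tri : ∀ v ∈ K, ∃ a ∈ K, ∃ b ∈ K, G.Adj v a ∧ G.Adj v b ∧ G.Adj a b
  k4 : ∀ a ∈ K, ∀ b ∈ K, ∀ c ∈ K, ∀ d ∈ K, G.Adj a b → G.Adj a c → G.Adj a d → G.Adj b c → G.Adj b d →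
    G.Adj c d → False
  mx : ∀ m f, LP G K m f → m ≤ n

theorem LP.comp {K : Set V} {n : ℕ} {f : ℕ → V} (h : LP G K n f) (σ : ℕ → ℕ) (h1 : ∀ k < n, σ k < n)
    (h2 : ∀ a b, a < n → b < n → σ a = σ b → a = b) (h3 : ∀ k, k + 1 < n → G.Adj (f (σ k)) (f (σ (k+1)))) :
    LP G K n (fun k => f (σ k)) where
  mem k hk := h.mem _ (h1 k hk)
  adj := h3
  inj a b ha hb e := h2 a b ha hb (h.inj _ _ (h1 _ ha) (h1 _ hb) e)

section
variable {K : Set V} {n : ℕ} {f : ℕ → V}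

theorem LP.ne (h : LP G K n f) {a b : ℕ} (hab : a ≠ b) (ha : a < n) (hb : b < n) : f a ≠ f b :=
  fun e => hab (h.inj a b ha hb e)

theorem LP.ends (h : LP G K n f) (T : TK G K n) {y : V} (hy : y ∈ K) (hadj : G.Adj (f 0) y) :
    ∃ a, 1 ≤ a ∧ a < n ∧ y = f a := by
  by_contra hne
  push Not at hne
  have h0 : ∀ a < n, y ≠ f a := by
    intro a ha
    rcases Nat.eq_zero_or_pos a with rfl | hp
    · exact hadj.ne.symm
    · exact hne a hp ha
  have : LP G K (n+1) (fun k => if k = 0 then y else f (k-1)) := by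
    refine ⟨?_, ?_, ?_⟩
    · intro k hk
      by_cases e : k = 0
      · simp [e, hy]
      · simp [e]; exact h.mem _ (by omega)
    · intro k hk
      by_cases e : k = 0
      · simp [e]; exact hadj.symm
      · have := h.adj (k-1) (by omega)
        simp [e]; rwa [show k - 1 + 1 = k by omega] at this
    · intro a b ha hb e
      by_cases ea : a = 0 <;> by_cases eb : b = 0
      · omega
      · simp [ea, eb] at e; exact absurd e (h0 _ (by omega))
      · simp [ea, eb] at e; exact absurd e.symm (h0 _ (by omega))
      · simp [ea, eb] at e; have := h.inj _ _ (by omega) (by omega) e; omega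
  have := T.mx _ _ this
  omega

/-- cycle via index function -/
theorem LP.cyc (h : LP G K n f) (T : TK G K n) (σ : ℕ → ℕ) (l : ℕ) (hl : l % 2 = 1) (hl3 : 3 ≤ l)
    (h1 : ∀ k < l, σ k < n) (h2 : ∀ a b, a < b → b < l → σ a < σ b)
    (h3 : ∀ k, k + 1 < l → G.Adj (f (σ k)) (f (σ (k+1)))) (h4 : G.Adj (f (σ (l-1))) (f (σ 0))) : l = 3 :=
  T.oc _ _ (oc_fn (fun k => f (σ k)) hl hl3 (fun a b hab hb e => by
    have := h.inj _ _ (h1 a (by omega)) (h1 b hb) e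
    have := h2 a b hab hb
    omega) h3 h4 (fun k hk => h.mem _ (h1 k hk)))

theorem LP.E (h : LP G K n f) (T : TK G K n) (hn : 0 < n) :
    3 ≤ n ∧ G.Adj (f 0) (f 1) ∧
    ((G.Adj (f 0) (f 2) ∧ ∀ y ∈ K, G.Adj (f 0) y → y = f 1 ∨ y = f 2 ∨ (3 < n ∧ y = f 3)) ∨
     (¬ G.Adj (f 0) (f 2) ∧ 3 < n ∧ G.Adj (f 0) (f 3) ∧ G.Adj (f 1) (f 3) ∧
      ∀ y ∈ K, G.Adj (f 0) y → y = f 1 ∨ y = f 3)) := by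
  have ev : ∀ a, 1 ≤ a → a < n → G.Adj (f 0) (f a) → a % 2 = 0 → a = 2 := by
    intro a h1 h2 h3 h4
    have := h.cyc T id (a+1) (by omega) (by omega) (by simp; omega) (by intros; simp; omega) (fun k hk => h.adj k (by omega))
      (by simpa using h3.symm)
    omega
  have od : ∀ a b, 1 ≤ a → a < b → b < n → G.Adj (f 0) (f a) → G.Adj (f 0) (f b) → (b - a) % 2 = 1 → b = a + 1 := by
    intro a b h1 h2 h3 h4 h5 h6
    have := h.cyc T (fun k => if k = 0 then 0 else a + k - 1) (b - a + 2) (by omega) (by omega)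
      (by intro k hk; split_ifs <;> omega) (by intro x y hx hy; split_ifs <;> omega)
      (by
        intro k hk
        by_cases e : k = 0
        · simpa [e] using h4
        · simp [e]
          have := h.adj (a + k - 1) (by omega)
          rwa [show a + k - 1 + 1 = a + k by omega] at this)
      (by simp; rw [show a + (b - a) = b by omega]; exact h5.symm)
    omega
  obtain ⟨p, hp, q, hq, h1, h2, h3⟩ := T.tri _ (h.mem 0 hn)
  -- indices
  have key : ∃ a b, 1 ≤ a ∧ a < b ∧ b < n ∧ G.Adj (f 0) (f a) ∧ G.Adj (f 0) (f b) ∧ G.Adj (f a) (f b) := by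
    obtain ⟨a, a1, a2, rfl⟩ := h.ends T hp h1
    obtain ⟨b, b1, b2, rfl⟩ := h.ends T hq h2
    rcases lt_trichotomy a b with e | e | e
    · exact ⟨a, b, a1, e, b2, h1, h2, h3⟩
    · subst e; exact absurd rfl h3.ne
    · exact ⟨b, a, b1, e, a2, h2, h1, h3.symm⟩
  obtain ⟨a, b, a1, hab, bn, ha, hb, hadj⟩ := key
  have h01 := h.adj 0 (by omega)
  refine ⟨by omega, h01, ?_⟩
  by_cases h2 : G.Adj (f 0) (f 2)
  · left
    refine ⟨h2, fun y hy hya => ?_⟩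
    obtain ⟨c, c1, c2, rfl⟩ := h.ends T hy hya
    by_cases c0 : c % 2 = 0
    · have := ev c c1 c2 hya c0
      subst this; simp
    · by_cases e : c = 1
      · subst e; simp
      · have := od 2 c (by omega) (by omega) c2 h2 hya (by omega)
        subst this; right; right; exact ⟨c2, rfl⟩
  · right
    have ao : a % 2 = 1 := by
      by_contra hh
      have := ev a a1 (by omega) ha (by omega)
      subst this; exact h2 ha
    have bo : b % 2 = 1 := by
      by_contra hh
      have := ev b (by omega) bn hb (by omega)
      subst this; exact h2 hb
    have ea : a = 1 := by
      have := h.cyc T (fun k => if k = a + 1 then b else k) (a + 2) (by omega) (by omega)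
        (by intro k hk; split_ifs <;> omega) (by intro x y hx hy; split_ifs <;> omega)
        (by
          intro k hk
          by_cases e : k = a
          · subst e; simpa
          · have : k ≠ a + 1 := by omega
            simp [this, e]
            exact h.adj k (by omega))
        (by simpa using hb.symm)
      omega
    subst ea
    have eb : b = 3 := by
      have := h.cyc T (fun k => k + 1) b (by omega) (by omega) (by intro k hk; omega) (by intro x y hx hy; omega)
        (by intro k hk; exact h.adj _ (by omega)) (by simp; rw [show b - 1 + 1 = b by omega]; exact hadj.symm)
      omega
    subst eb
    refine ⟨h2, bn, hb, hadj, fun y hy hya => ?_⟩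
    obtain ⟨c, c1, c2, rfl⟩ := h.ends T hy hya
    have co : c % 2 = 1 := by
      by_contra hh
      have := ev c c1 c2 hya (by omega)
      subst this; exact h2 hya
    by_cases e : c = 1
    · subst e; simp
    · have := h.cyc T (fun k => if k < 2 then k else k + 1) c (by omega) (by omega)
        (by intro k hk; split_ifs <;> omega) (by intro x y hx hy; split_ifs <;> omega)
        (by
          intro k hk
          by_cases e : k = 0
          · subst e; simpa
          by_cases e1 : k = 1
          · subst e1; simpa
          · have : ¬ k < 2 := by omega
            have : ¬ k < 1 := by omega
            simp [*]
            exact h.adj (k+1) (by omega))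
        (by
          have : ¬ c - 1 < 2 := by omega
          simp only [this, if_false]
          rw [show c - 1 + 1 = c by omega]
          simpa using hya.symm)
      subst this; simp

/-- end structure -/
def EndS (G : SimpleGraph V) (K : Set V) : Prop :=
  (∃ p ∈ K, ∃ q ∈ K, ∃ r ∈ K, ∃ s ∈ K, p ≠ s ∧ G.Adj q r ∧ G.Adj p q ∧ G.Adj p r ∧ G.Adj s q ∧ G.Adj s r ∧
    (∀ y ∈ K, G.Adj p y → y = q ∨ y = r) ∧ (∀ y ∈ K, G.Adj s y → y = q ∨ y = r)) ∨
  (∃ s ∈ K, ∃ t ∈ K, ∃ v ∈ K, G.Adj s t ∧ G.Adj s v ∧ G.Adj t v ∧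
    (∀ y ∈ K, G.Adj s y → y = t ∨ y = v) ∧ (∀ y ∈ K, G.Adj t y → y = s ∨ y = v)) ∨
  (∃ c ∈ K, ∃ a ∈ K, ∃ b ∈ K, ∃ v ∈ K, G.Adj c a ∧ G.Adj c b ∧ G.Adj a b ∧ G.Adj a v ∧ G.Adj b v ∧ c ≠ v ∧
    (∀ y ∈ K, G.Adj c y → y = a ∨ y = b) ∧ (∀ y ∈ K, G.Adj a y → y = c ∨ y = b ∨ y = v) ∧
    (∀ y ∈ K, G.Adj b y → y = c ∨ y = a ∨ y = v))

theorem LP.swap01 (h : LP G K n f) (hn : 3 ≤ n) (h02 : G.Adj (f 0) (f 2)) :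
    LP G K n (fun k => f (if k = 0 then 1 else if k = 1 then 0 else k)) := by
  refine h.comp _ (by intro k hk; split_ifs <;> omega) (by intro a b _ _ e; split_ifs at e <;> omega) ?_
  intro k hk
  by_cases e : k = 0
  · subst e; simpa using (h.adj 0 (by omega)).symm
  by_cases e1 : k = 1
  · subst e1; simpa
  · simp [*]; exact h.adj k hk

theorem LP.caseI (h : LP G K n f) (T : TK G K n) (hn : 3 ≤ n) (h02 : G.Adj (f 0) (f 2))
    (hN : ∀ y ∈ K, G.Adj (f 0) y → y = f 1 ∨ y = f 2) : EndS G K := by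
  have a01 := h.adj 0 (by omega)
  have a12 := h.adj 1 (by omega)
  simp only [zero_add] at a01
  have H1 := h.swap01 hn h02
  obtain ⟨_, _, E1⟩ := H1.E T (by omega)
  simp only [reduceIte, one_ne_zero, OfNat.ofNat_ne_zero, OfNat.ofNat_ne_one] at E1
  have N1 := (E1.resolve_right (fun h => h.1 a12)).2
  by_cases h13 : 3 < n ∧ G.Adj (f 1) (f 3)
  · obtain ⟨h3, h13⟩ := h13
    right; right
    have a23 := h.adj 2 (by omega)
    have H2 : LP G K n (fun k => f (if k = 0 then 2 else if k = 1 then 0 else if k = 2 then 1 else k)) := by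
      refine h.comp _ (by intro k hk; split_ifs <;> omega) (by intro a b _ _ e; split_ifs at e <;> omega) ?_
      intro k hk
      by_cases e : k = 0
      · subst e; simpa using h02.symm
      by_cases e1 : k = 1
      · subst e1; simpa
      by_cases e1 : k = 2
      · subst e1; simpa
      · simp [*]; exact h.adj k hk
    obtain ⟨_, _, E2⟩ := H2.E T (by omega)
    simp only [reduceIte, one_ne_zero, OfNat.ofNat_ne_zero, OfNat.ofNat_ne_one] at E2
    have N2 := (E2.resolve_right (fun h => h.1 a12.symm)).2
    refine ⟨f 0, h.mem _ (by omega), f 1, h.mem _ (by omega), f 2, h.mem _ (by omega), f 3, h.mem _ (by omega),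
      a01, h02, a12, h13, a23, h.ne (by omega) (by omega) (by omega), hN, ?_, ?_⟩
    · intro y hy hya; have := N1 y hy hya; tauto
    · intro y hy hya; have := N2 y hy hya; simp at this; tauto
  · right; left
    refine ⟨f 0, h.mem _ (by omega), f 1, h.mem _ (by omega), f 2, h.mem _ (by omega), a01, h02, a12, hN, ?_⟩
    intro y hy hya
    have := N1 y hy hya
    rcases this with e | e | ⟨e0, e⟩
    · exact Or.inl e
    · exact Or.inr e
    · subst e; exact absurd ⟨e0, hya⟩ h13

theorem LP.endS (h : LP G K n f) (T : TK G K n) (hn : 0 < n) : EndS G K := by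
  obtain ⟨h3, a01, ⟨h02, N⟩ | ⟨h02, hn3, h03, h13, N⟩⟩ := h.E T hn
  · by_cases e3 : 3 < n ∧ G.Adj (f 0) (f 3)
    · obtain ⟨hn3, h03⟩ := e3
      have a12 := h.adj 1 (by omega)
      have a23 := h.adj 2 (by omega)
      have H1 := h.swap01 h3 h02
      obtain ⟨_, _, E1⟩ := H1.E T (by omega)
      simp only [reduceIte, one_ne_zero, OfNat.ofNat_ne_zero, OfNat.ofNat_ne_one] at E1
      have N1 := (E1.resolve_right (fun h => h.1 a12)).2
      refine H1.caseI T h3 (by simpa) ?_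
      intro y hy hya
      simp at hya ⊢
      rcases N1 y hy hya with e | e | ⟨_, e⟩
      · exact Or.inl e
      · exact Or.inr e
      · subst e
        exact (T.k4 _ (h.mem 0 (by omega)) _ (h.mem 1 (by omega)) _ (h.mem 2 (by omega)) _ (h.mem 3 (by omega))
          a01 h02 h03 a12 hya a23).elim
    · refine h.caseI T h3 h02 ?_
      intro y hy hya
      rcases N y hy hya with e | e | ⟨e0, e⟩
      · exact Or.inl e
      · exact Or.inr e
      · subst e; exact absurd ⟨e0, hya⟩ e3
  · left
    have a12 := h.adj 1 (by omega)
    have a23 := h.adj 2 (by omega)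
    have H2 : LP G K n (fun k => f (if k = 0 then 2 else if k = 2 then 0 else k)) := by
      refine h.comp _ (by intro k hk; split_ifs <;> omega) (by intro a b _ _ e; split_ifs at e <;> omega) ?_
      intro k hk
      by_cases e : k = 0
      · subst e; simpa using a12.symm
      by_cases e1 : k = 1
      · subst e1; simpa using a01.symm
      by_cases e1 : k = 2
      · subst e1; simpa
      · simp [*]; exact h.adj k hk
    obtain ⟨_, _, E2⟩ := H2.E T (by omega)
    simp only [reduceIte, one_ne_zero, OfNat.ofNat_ne_zero] at E2
    rcases E2 with E2 | E2
    · exact absurd (by simpa using E2.1.symm) h02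
    · obtain ⟨_, _, _, _, N2⟩ := E2
      refine ⟨f 0, h.mem _ (by omega), f 1, h.mem _ (by omega), f 3, h.mem _ (by omega), f 2, h.mem _ (by omega),
        h.ne (by omega) (by omega) (by omega), h13, a01, h03, a12.symm, a23, N, ?_⟩
      intro y hy hya; have := N2 y hy hya; simp at this; tauto

end

theorem exists_endS [Finite V] {K : Set V} (hne : K.Nonempty) (oc : ∀ n c, OC G K n c → n = 3)
    (tri : ∀ v ∈ K, ∃ a ∈ K, ∃ b ∈ K, G.Adj v a ∧ G.Adj v b ∧ G.Adj a b)
    (k4 : ∀ a ∈ K, ∀ b ∈ K, ∀ c ∈ K, ∀ d ∈ K, G.Adj a b → G.Adj a c → G.Adj a d → G.Adj b c → G.Adj b d →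
    G.Adj c d → False) : EndS G K := by
  obtain ⟨v, hv⟩ := hne
  have : Fintype V := Fintype.ofFinite V
  obtain ⟨n, ⟨f, hf⟩, hmax⟩ := exists_max (P := fun n => ∃ f, LP G K n f) (b := Fintype.card V)
    ⟨1, fun _ => v, fun _ _ => hv, by omega, by omega⟩ (by
      rintro k ⟨f, hf⟩
      have := Fintype.card_le_of_injective (fun a : Fin k => f a) (fun a b e => Fin.ext (hf.inj _ _ a.2 b.2 e))
      simpa using this)
  have h1 := hmax 1 ⟨fun _ => v, fun _ _ => hv, by omega, by omega⟩
  exact hf.endS ⟨oc, tri, k4, fun m f h => hmax m ⟨f, h⟩⟩ h1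

end FC

namespace FC
open SimpleGraph

variable {V : Type*} {G : SimpleGraph V}

theorem OC.nbrs {S : Set V} {n : ℕ} {c : ℕ → V} (C : OC G S n c) (k : ℕ) :
    ∃ a ∈ S, ∃ b ∈ S, a ≠ b ∧ G.Adj (c k) a ∧ G.Adj (c k) b := by
  have h3 := C.three
  refine ⟨c (k+1), C.mem _, c (k+n-1), C.mem _, C.ne_of (by omega) (by omega), C.adj k, ?_⟩
  have := C.adj (k+n-1)
  rw [show k + n - 1 + 1 = k + n by omega, C.per] at this
  exact this.symm

theorem OC.tri {S : Set V} {c : ℕ → V} (C : OC G S 3 c) (k : ℕ) :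
    ∃ a ∈ S, ∃ b ∈ S, G.Adj (c k) a ∧ G.Adj (c k) b ∧ G.Adj a b := by
  refine ⟨c (k+1), C.mem _, c (k+2), C.mem _, C.adj k, ?_, C.adj (k+1)⟩
  have := C.adj (k+2)
  rw [show k + 2 + 1 = k + 3 by omega, C.per] at this
  exact this.symm

def Solv (G : SimpleGraph V) (U K : Set V) : Prop :=
  ∃ Z, Z ⊆ K ∧ (∀ z ∈ Z, z ∉ U) ∧ (∀ x ∈ Z, ∀ y ∈ Z, ¬ G.Adj x y) ∧ ∀ n c, ¬ OC G (K \ Z) n c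

theorem Solv.mono {U K K' : Set V} (h : Solv G U K) (hK : K' ⊆ K) : Solv G U K' := by
  obtain ⟨Z, h1, h2, h3, h4⟩ := h
  refine ⟨Z ∩ K', Set.inter_subset_right, fun z hz => h2 z hz.1, fun x hx y hy => h3 x hx.1 y hy.1, ?_⟩
  intro n c C
  exact h4 n c (C.mono fun k => ⟨hK (C.mem k).1, fun hz => (C.mem k).2 ⟨hz, (C.mem k).1⟩⟩)

section
variable {U K : Set V}

/-- minimal non solvable -/
structure Crit (G : SimpleGraph V) (U K : Set V) : Prop where
  not : ¬ Solv G U K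
  sub : ∀ v ∈ K, Solv G U (K \ {v})

theorem thru {Z : Set V} {v : V} (h : ∀ n c, ¬ OC G ((K \ {v}) \ Z) n c) {n : ℕ} {c : ℕ → V} (C : OC G (K \ Z) n c) :
    ∃ k, c k = v := by
  by_contra hh
  push Not at hh
  exact h n c (C.mono fun k => ⟨⟨(C.mem k).1, by simpa using hh k⟩, (C.mem k).2⟩)

theorem Crit.on (H : Crit G U K) {v : V} (hv : v ∈ K) : ∃ n c k, OC G K n c ∧ c k = v := by
  by_contra hh
  push Not at hh
  obtain ⟨Z, h1, h2, h3, h4⟩ := H.sub v hv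
  refine H.not ⟨Z, h1.trans Set.sdiff_subset, h2, h3, fun n c C => ?_⟩
  obtain ⟨k, hk⟩ := thru h4 C
  exact hh n c k (C.mono fun k => (C.mem k).1) hk

theorem Crit.deg (H : Crit G U K) {v a b : V} (hv : v ∈ K) (hN : ∀ y ∈ K, G.Adj v y → y = a ∨ y = b) : v ∈ U := by
  by_contra hU
  obtain ⟨Z, h1, h2, h3, h4⟩ := H.sub v hv
  by_cases hz : ∃ y ∈ Z, G.Adj v y
  · obtain ⟨y, hy, hvy⟩ := hz
    refine H.not ⟨Z, h1.trans Set.sdiff_subset, h2, h3, fun n c C => ?_⟩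
    obtain ⟨k, rfl⟩ := thru h4 C
    obtain ⟨p, hp, q, hq, hpq, k1, k2⟩ := C.nbrs k
    have e1 := hN p hp.1 k1
    have e2 := hN q hq.1 k2
    have e3 := hN y (h1 hy).1 hvy
    have n1 : y ≠ p := by rintro rfl; exact hp.2 hy
    have n2 : y ≠ q := by rintro rfl; exact hq.2 hy
    grind
  · push Not at hz
    refine H.not ⟨insert v Z, ?_, ?_, ?_, ?_⟩
    · intro x hx
      rcases hx with rfl | hx
      exacts [hv, (h1 hx).1]
    · rintro z (rfl | hz')
      exacts [hU, h2 z hz']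
    · rintro x (rfl | hx) y (rfl | hy)
      · exact G.loopless.irrefl _
      · exact hz y hy
      · exact fun h => hz x hx h.symm
      · exact h3 x hx y hy
    · intro n c C
      refine h4 n c (C.mono fun k => ⟨⟨(C.mem k).1, ?_⟩, ?_⟩)
      · have := (C.mem k).2; simp at this ⊢; tauto
      · have := (C.mem k).2; simp at this ⊢; tauto

theorem Crit.main [Finite V] (H : Crit G U K) (oc : ∀ n c, OC G K n c → n = 3)
    (k4 : ∀ a ∈ K, ∀ b ∈ K, ∀ c ∈ K, ∀ d ∈ K, G.Adj a b → G.Adj a c → G.Adj a d → G.Adj b c → G.Adj b d →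
    G.Adj c d → False) :
    (∃ s ∈ K, ∃ t ∈ K, ∃ v ∈ K, G.Adj s t ∧ G.Adj s v ∧ G.Adj t v ∧ s ∈ U ∧ t ∈ U ∧
      (v ∈ U ∨ ∃ p ∈ K, ∃ x ∈ K, ∃ y ∈ K, G.Adj v p ∧ G.Adj p x ∧ G.Adj p y ∧ G.Adj x y ∧
        p ≠ s ∧ p ≠ t ∧ x ≠ s ∧ x ≠ t ∧ y ≠ s ∧ y ≠ t)) ∨
    (∃ c ∈ K, ∃ a ∈ K, ∃ b ∈ K, ∃ v ∈ K, ∃ p ∈ K, ∃ x ∈ K, ∃ y ∈ K, c ∈ U ∧ G.Adj c a ∧ G.Adj c b ∧ G.Adj a b ∧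
      G.Adj a v ∧ G.Adj b v ∧ c ≠ v ∧ G.Adj v p ∧ G.Adj p x ∧ G.Adj p y ∧ G.Adj x y ∧
      p ≠ a ∧ p ≠ b ∧ p ≠ c ∧ x ≠ a ∧ x ≠ b ∧ x ≠ c ∧ y ≠ a ∧ y ≠ b ∧ y ≠ c) := by
  have tri : ∀ v ∈ K, ∃ a ∈ K, ∃ b ∈ K, G.Adj v a ∧ G.Adj v b ∧ G.Adj a b := by
    intro v hv
    obtain ⟨n, c, k, C, rfl⟩ := H.on hv
    have := oc n c C
    subst this
    exact C.tri k
  have hne : K.Nonempty := by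
    by_contra hh
    rw [Set.not_nonempty_iff_eq_empty] at hh
    exact H.not ⟨∅, by simp, by simp, by simp, fun n c C => by have := C.mem 0; simp [hh] at this⟩
  rcases exists_endS hne oc tri k4 with ⟨p, hp, q, hq, r, hr, s, hs, ps, qr, pq, pr, sq, sr, Np, Ns⟩ |
    ⟨s, hs, t, ht, v, hv, st, sv, tv, Ns, Nt⟩ | ⟨c, hc, a, ha, b, hb, v, hv, ca, cb, ab, av, bv, cv, Nc, Na, Nb⟩
  · exfalso
    have pU := H.deg hp Np
    obtain ⟨Z, h1, h2, h3, h4⟩ := H.sub s hs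
    have hqr : q ∈ Z ∨ r ∈ Z := by
      by_contra hh
      push Not at hh
      refine h4 _ _ (oc_tri (a := p) (b := q) (c := r) ⟨⟨hp, ps⟩, fun h => h2 _ h pU⟩ ⟨⟨hq, sq.ne.symm⟩, hh.1⟩
        ⟨⟨hr, sr.ne.symm⟩, hh.2⟩ pq qr pr.symm)
    refine H.not ⟨Z, h1.trans Set.sdiff_subset, h2, h3, fun n c C => ?_⟩
    obtain ⟨k, rfl⟩ := thru h4 C
    obtain ⟨x, hx, y, hy, hxy, k1, k2⟩ := C.nbrs k
    have e1 := Ns x hx.1 k1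
    have e2 := Ns y hy.1 k2
    have := hx.2
    have := hy.2
    grind
  · left
    refine ⟨s, hs, t, ht, v, hv, st, sv, tv, H.deg hs Ns, H.deg ht Nt, ?_⟩
    by_cases hN : ∀ y ∈ K, G.Adj v y → y = s ∨ y = t
    · exact Or.inl (H.deg hv hN)
    · right
      push Not at hN
      obtain ⟨p, hp, vp, n1, n2⟩ := hN
      obtain ⟨x, hx, y, hy, px, py, xy⟩ := tri p hp
      have key : ∀ x, G.Adj p x → x ≠ s ∧ x ≠ t := by
        intro x px
        constructor
        · rintro rfl; rcases Ns p hp px.symm with e | e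
          exacts [n2 e, vp.ne.symm e]
        · rintro rfl; rcases Nt p hp px.symm with e | e
          exacts [n1 e, vp.ne.symm e]
      exact ⟨p, hp, x, hx, y, hy, vp, px, py, xy, n1, n2, (key x px).1, (key x px).2, (key y py).1, (key y py).2⟩
  · have cU := H.deg hc Nc
    by_cases hU : a ∈ U ∧ b ∈ U
    · left
      exact ⟨a, ha, b, hb, c, hc, ab, ca.symm, cb.symm, hU.1, hU.2, Or.inl cU⟩
    right
    have hN : ¬ ∀ y ∈ K, G.Adj v y → y = a ∨ y = b := by
      intro Nv
      have vU := H.deg hv Nv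
      have key : ∀ a b, a ∈ K → b ∈ K → a ∉ U → G.Adj c a → G.Adj a v → (∀ y ∈ K, G.Adj c y → y = a ∨ y = b) →
        (∀ y ∈ K, G.Adj v y → y = a ∨ y = b) →
        (∀ y ∈ K, G.Adj a y → y = c ∨ y = b ∨ y = v) → (∀ y ∈ K, G.Adj b y → y = c ∨ y = a ∨ y = v) → False := by
        intro a b ha hb aU ca av Nc Nv Na Nb
        obtain ⟨Z, h1, h2, h3, h4⟩ := (H.sub a ha).mono (K' := K \ {a, b, c, v}) (by intro x; simp; tauto)
        refine H.not ⟨insert a Z, ?_, ?_, ?_, ?_⟩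
        · intro x hx
          rcases hx with rfl | hx
          exacts [ha, (h1 hx).1]
        · rintro z (rfl | hz')
          exacts [aU, h2 z hz']
        · have : ∀ x ∈ Z, ¬ G.Adj a x := by
            intro x hx hax
            have e := Na x (h1 hx).1 hax
            have := (h1 hx).2
            simp at this
            tauto
          rintro x (rfl | hx) y (rfl | hy)
          · exact G.loopless.irrefl _
          · exact this y hy
          · exact fun h => this x hx h.symm
          · exact h3 x hx y hy
        · intro n f C
          have nc : ∀ k, f k ≠ c := by
            intro k e
            obtain ⟨x, hx, y, hy, hxy, k1, k2⟩ := C.nbrs k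
            rw [e] at k1 k2
            have e1 := Nc x hx.1 k1
            have e2 := Nc y hy.1 k2
            have := hx.2
            have := hy.2
            simp at *; grind
          have nv : ∀ k, f k ≠ v := by
            intro k e
            obtain ⟨x, hx, y, hy, hxy, k1, k2⟩ := C.nbrs k
            rw [e] at k1 k2
            have e1 := Nv x hx.1 k1
            have e2 := Nv y hy.1 k2
            have := hx.2
            have := hy.2
            simp at *; grind
          have na : ∀ k, f k ≠ a := by
            intro k e
            exact (C.mem k).2 (Or.inl e)
          have nb : ∀ k, f k ≠ b := by
            intro k e
            have h1 := C.adj k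
            rw [e] at h1
            rcases Nb _ (C.mem (k+1)).1 h1 with e | e | e
            exacts [nc _ e, na _ e, nv _ e]
          refine h4 n f (C.mono fun k => ⟨⟨(C.mem k).1, ?_⟩, fun h => (C.mem k).2 (Or.inr h)⟩)
          simp [na k, nb k, nc k, nv k]
      by_cases aU : a ∈ U
      · exact key b a hb ha (fun bU => hU ⟨aU, bU⟩) cb bv (fun y h1 h2 => (Nc y h1 h2).symm)
          (fun y h1 h2 => (Nv y h1 h2).symm) Nb Na
      · exact key a b ha hb aU ca av Nc Nv Na Nb
    push Not at hN
    obtain ⟨p, hp, vp, n1, n2⟩ := hN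
    obtain ⟨x, hx, y, hy, px, py, xy⟩ := tri p hp
    have n3 : p ≠ c := by
      rintro rfl
      rcases Nc v hv vp.symm with e | e
      exacts [av.ne e.symm, bv.ne e.symm]
    have n4 := vp.ne
    have key : ∀ x, G.Adj p x → x ≠ a ∧ x ≠ b ∧ x ≠ c := by
      intro x px
      refine ⟨?_, ?_, ?_⟩
      · rintro rfl; have := Na p hp px.symm; grind
      · rintro rfl; have := Nb p hp px.symm; grind
      · rintro rfl; have := Nc p hp px.symm; grind
    obtain ⟨x1, x2, x3⟩ := key x px
    obtain ⟨y1, y2, y3⟩ := key y py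
    exact ⟨c, hc, a, ha, b, hb, v, hv, p, hp, x, hx, y, hy, cU, ca, cb, ab, av, bv, cv, vp, px, py, xy,
      n1, n2, n3, x1, x2, x3, y1, y2, y3⟩

end

/-- no K4 away from the root -/
def NK4 (B : BFS G) : Prop := ∀ a b c d, 0 < B.lev a → 0 < B.lev b → 0 < B.lev c → 0 < B.lev d →
  G.Adj a b → G.Adj a c → G.Adj a d → G.Adj b c → G.Adj b d → G.Adj c d → False

structure LZ (B : BFS G) (i : ℕ) (Z : Set V) : Prop where
  sub : Z ⊆ B.L i
  ind : ∀ x ∈ Z, ∀ y ∈ Z, ¬ G.Adj x y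
  on : ∀ z ∈ Z, ∃ n c, OC G (B.L i) n c ∧ c 0 = z
  no : ∀ n c, ¬ OC G (B.L i \ Z) n c

theorem no_oc0 (B : BFS G) {n : ℕ} {c : ℕ → V} (C : OC G (B.L 0) n c) : False := by
  have := B.root _ _ (C.mem 0) (C.mem 1)
  exact (C.adj 0).ne this

theorem LZ.zero (B : BFS G) : LZ B 0 ∅ :=
  ⟨by simp, by simp, by simp, fun n c C => no_oc0 B (C.mono fun k => (C.mem k).1)⟩

theorem LZ.step [Finite V] {B : BFS G} (hD : ¬ Done G) (h4 : NK4 B) {i : ℕ} {Z : Set V} (Y : LZ B i Z) :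
    ∃ Z', LZ B (i+1) Z' ∧ ∀ x ∈ Z', ∀ y ∈ Z, ¬ G.Adj x y := by
  classical
  set U : Set V := {u | ∃ z ∈ Z, G.Adj u z} with hU
  suffices hs : Solv G U (B.L (i+1)) by
    obtain ⟨W, h1, h2, h3, h4⟩ := hs
    refine ⟨{w | w ∈ W ∧ ∃ n c, OC G (B.L (i+1)) n c ∧ c 0 = w}, ⟨fun x hx => h1 hx.1,
      fun x hx y hy => h3 x hx.1 y hy.1, fun z hz => hz.2, ?_⟩, ?_⟩
    · intro n c C
      refine h4 n c (C.mono fun k => ⟨(C.mem k).1, fun hk => (C.mem k).2 ⟨hk, n, _, ((C.shift k).mono (fun j => (C.mem _).1)), ?_⟩⟩)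
      simp
    · intro x hx y hy hxy
      exact h2 x hx.1 ⟨y, hy, hxy⟩
  by_contra hns
  obtain ⟨K, hKL, hmin⟩ := exists_minimal_le_of_wellFoundedLT (fun K : Set V => ¬ Solv G U K) _ hns
  have H : Crit G U K := by
    refine ⟨hmin.1, fun v hv => ?_⟩
    by_contra hh
    have := hmin.2 hh Set.sdiff_subset hv
    exact this.2 rfl
  have gad : ∀ z ∈ Z, ∃ h m, Gad B i h z m := by
    intro z hz
    obtain ⟨n, c, C, rfl⟩ := Y.on z hz
    obtain ⟨h, H⟩ := C.exists_h
    exact ⟨h, H.gad hD 0⟩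
  have oc : ∀ n c, OC G K n c → n = 3 := by
    intro n c C
    by_contra hn
    have h5 : 5 ≤ n := by have := C.odd; have := C.three; omega
    have C' : OC G (B.L (i+1)) n c := C.mono fun k => hKL (C.mem k)
    obtain ⟨h, OH⟩ := C'.exists_h
    obtain ⟨k, hk⟩ := OH.lemP hD h5
    have := H.deg (C.mem (k+2)) (fun y hy => hk y (hKL hy))
    obtain ⟨z, hz, hadj⟩ := this
    obtain ⟨h', m, D⟩ := gad z hz
    exact D.noLong hD (C'.shift (k+2)) h5 (by simpa using hadj)
  have lz : ∀ z ∈ Z, 0 < B.lev z := by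
    intro z hz
    obtain ⟨n, c, C, rfl⟩ := Y.on z hz
    have := C.mem 0
    rw [B.mem_L] at this
    rcases Nat.eq_zero_or_pos i with rfl | hp
    · exact (no_oc0 B C).elim
    · omega
  have lK : ∀ x ∈ K, 0 < B.lev x := by
    intro x hx
    have := hKL hx
    have : B.lev x = i + 1 := this
    omega
  have k4 : ∀ a ∈ K, ∀ b ∈ K, ∀ c ∈ K, ∀ d ∈ K, G.Adj a b → G.Adj a c → G.Adj a d → G.Adj b c → G.Adj b d →
    G.Adj c d → False := fun a ha b hb c hc d hd => h4 a b c d (lK a ha) (lK b hb) (lK c hc) (lK d hd)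
  have d1 : ∀ u1 ∈ K, ∀ u2 ∈ K, ∀ u3 ∈ K, G.Adj u1 u2 → G.Adj u1 u3 → G.Adj u2 u3 → ∀ z1 ∈ Z, ∀ z2 ∈ Z,
      G.Adj u1 z1 → G.Adj u2 z2 → z1 = z2 := by
    intro u1 m1 u2 m2 u3 m3 a12 a13 a23 z1 hz1 z2 hz2 b1 b2
    by_contra hne
    have na := Y.ind z1 hz1 z2 hz2
    obtain ⟨n1, c1, C1, rfl⟩ := Y.on z1 hz1
    obtain ⟨n2, c2, C2, rfl⟩ := Y.on z2 hz2
    exact D1 hD C1 C2 (hKL m1) (hKL m2) (hKL m3) a12 a13 a23 b1 b2 hne na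
  rcases H.main oc k4 with ⟨s, hs, t, ht, v, hv, st, sv, tv, sU, tU, hh⟩ |
    ⟨c, hc, a, ha, b, hb, v, hv, p, hp, x, hx, y, hy, cU, ca, cb, ab, av, bv, cv, vp, px, py, xy,
      n1, n2, n3, x1, x2, x3, y1, y2, y3⟩
  · obtain ⟨z, hz, sz⟩ := sU
    obtain ⟨z', hz', tz⟩ := tU
    obtain rfl := d1 s hs t ht v hv st sv tv z hz z' hz' sz tz
    have vz : ¬ G.Adj v z := fun vz => h4 s t v z (lK _ hs) (lK _ ht) (lK _ hv) (lz _ hz) st sv sz tv tz vz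
    rcases hh with vU | ⟨p, hp, x, hx, y, hy, vp, px, py, xy, n1, n2, n3, n4, n5, n6⟩
    · obtain ⟨z'', hz'', vz'⟩ := vU
      obtain rfl := d1 s hs v hv t ht sv st tv.symm z hz z'' hz'' sz vz'
      exact vz vz'
    · obtain ⟨h, m, D⟩ := gad z hz
      obtain ⟨w, hw, vw⟩ := B.exists_par (hKL hv)
      have hwz : w ≠ z := by rintro rfl; exact vz vw
      by_cases ex : x = v
      · subst ex
        exact D.D2bow hD (hKL hs) (hKL ht) (hKL hx) (hKL hp) (hKL hy) st sv tv sz tz hw vw hwz vp xy py n1 n2 n5 n6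
      by_cases ey : y = v
      · subst ey
        exact D.D2bow hD (hKL hs) (hKL ht) (hKL hy) (hKL hp) (hKL hx) st sv tv sz tz hw vw hwz vp xy.symm px n1 n2 n3 n4
      exact D.D2far hD (hKL hs) (hKL ht) (hKL hv) (hKL hp) (hKL hx) (hKL hy) st sv tv sz tz hw vw hwz vp px py xy
        n1 n2 n3 n4 ex n5 n6 ey
  · obtain ⟨z, hz, cz⟩ := cU
    obtain ⟨h, m, D⟩ := gad z hz
    by_cases az : G.Adj a z
    · have bz : ¬ G.Adj b z := fun bz => h4 a b c z (lK _ ha) (lK _ hb) (lK _ hc) (lz _ hz) ab ca.symm az cb.symm bz cz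
      exact D.D3 hD (hKL hc) (hKL hb) (hKL ha) (hKL hv) (hKL hp) (hKL hx) (hKL hy) cb ca ab.symm bv av cv cz bz
        vp px py xy n2 n1 n3 x2 x1 x3 y2 y1 y3
    · exact D.D3 hD (hKL hc) (hKL ha) (hKL hb) (hKL hv) (hKL hp) (hKL hx) (hKL hy) ca cb ab av bv cv cz az
        vp px py xy n1 n2 n3 x1 x2 x3 y1 y2 y3

end FC

namespace FC
open SimpleGraph

variable {V : Type*} {G : SimpleGraph V}

theorem oc_of_closed {S : Set V} (n : ℕ) : ∀ g : ℕ → V, n % 2 = 1 → (∀ k, g k ∈ S) →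
    (∀ k < n, G.Adj (g k) (g (k+1))) → g n = g 0 → ∃ n c, OC G S n c := by
  induction n using Nat.strong_induction_on with
  | _ n ih =>
  intro g ho hm ha hl
  by_cases hi : ∀ a b, a < b → b < n → g a ≠ g b
  · have h3 : 3 ≤ n := by
      by_contra hh
      have : n = 1 := by omega
      subst this
      have := ha 0 (by omega)
      rw [zero_add, hl] at this
      exact this.ne rfl
    refine ⟨n, _, oc_fn g ho h3 hi (fun k hk => ha k (by omega)) ?_ (fun k _ => hm k)⟩
    have := ha (n-1) (by omega)
    rwa [show n - 1 + 1 = n by omega, hl] at this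
  · push Not at hi
    obtain ⟨a, b, hab, hb, e⟩ := hi
    by_cases hp : (b - a) % 2 = 1
    · refine ih (b - a) (by omega) (fun k => g (a + k)) hp (fun k => hm _) (fun k hk => ?_) ?_
      · exact ha (a + k) (by omega)
      · simp only [add_zero]; rw [show a + (b - a) = b by omega, e]
    · refine ih (n - (b - a)) (by omega) (fun k => if k ≤ a then g k else g (k + (b - a))) (by omega)
        (fun k => by split_ifs <;> exact hm _) (fun k hk => ?_) ?_
      · rcases lt_trichotomy k a with h | h | h
        · have h1 : k ≤ a := by omega
          have h2 : k + 1 ≤ a := by omega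
          simp only [h1, h2, if_true]; exact ha k (by omega)
        · subst h
          simp only [le_refl, if_true]
          rw [if_neg (by omega), show k + 1 + (b - k) = b + 1 by omega, e]
          exact ha b hb
        · rw [if_neg (by omega), if_neg (by omega), show k + 1 + (b - a) = k + (b - a) + 1 by omega]
          exact ha _ (by omega)
      · rw [if_neg (by omega), if_pos (by omega), show n - (b - a) + (b - a) = n by omega, hl]

theorem two_col {S : Set V} (h : ∀ n c, ¬ OC G S n c) :
    ∃ f : V → ℕ, (∀ v, f v < 2) ∧ ∀ x ∈ S, ∀ y ∈ S, G.Adj x y → f x ≠ f y := by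
  classical
  have : (G.induce S).Colorable 2 := by
    rw [two_colorable_iff_forall_loop_even]
    intro u w
    by_contra hodd
    rw [Nat.not_even_iff_odd, Nat.odd_iff] at hodd
    obtain ⟨n, c, C⟩ := oc_of_closed (G := G) (S := S) w.length (fun k => (w.getVert k : V)) hodd
      (fun k => (w.getVert k).2) (fun k hk => by
        have := w.adj_getVert_succ hk
        exact this) (by simp)
    exact h n c C
  obtain ⟨C⟩ := this
  refine ⟨fun v => if hv : v ∈ S then (C ⟨v, hv⟩ : Fin 2).val else 0, ?_, ?_⟩
  · intro v
    dsimp only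
    split_ifs
    · exact (C _).2
    · omega
  · intro x hx y hy hxy
    simp only [hx, hy, dif_pos]
    intro e
    exact C.valid (show (G.induce S).Adj ⟨x, hx⟩ ⟨y, hy⟩ from hxy) (Fin.ext e)

theorem col5 [Finite V] {B : BFS G} (hD : ¬ Done G) (h4 : NK4 B) : G.Colorable 5 := by
  classical
  have step : ∀ (i : ℕ) (Z : Set V), ∃ Z', LZ B i Z → (LZ B (i+1) Z' ∧ ∀ x ∈ Z', ∀ y ∈ Z, ¬ G.Adj x y) := by
    intro i Z
    by_cases h : LZ B i Z
    · obtain ⟨Z', h'⟩ := LZ.step hD h4 h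
      exact ⟨Z', fun _ => h'⟩
    · exact ⟨∅, fun h' => absurd h' h⟩
  choose F hF using step
  let Z : ℕ → Set V := fun i => Nat.rec (motive := fun _ => Set V) ∅ F i
  have hZ : ∀ i, LZ B i (Z i) := by
    intro i
    induction i with
    | zero => exact LZ.zero B
    | succ i ih => exact (hF i (Z i) ih).1
  have hZ' : ∀ i, ∀ x ∈ Z (i+1), ∀ y ∈ Z i, ¬ G.Adj x y := fun i => (hF i (Z i) (hZ i)).2
  have hc := fun i => two_col (hZ i).no
  choose f hf1 hf2 using hc
  have lt : ∀ v : V, (if v ∈ Z (B.lev v) then (4:ℕ) else 2 * (B.lev v % 2) + f (B.lev v) v) < 5 := by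
    intro v
    have := hf1 (B.lev v) v
    split_ifs <;> omega
  refine ⟨Coloring.mk (fun v => (⟨_, lt v⟩ : Fin 5)) ?_⟩
  intro u v huv e
  rw [Fin.mk.injEq] at e
  have l1 := B.adj_lev _ _ huv
  have l2 := B.adj_lev _ _ huv.symm
  have f1 := hf1 (B.lev u) u
  have f2 := hf1 (B.lev v) v
  by_cases hu : u ∈ Z (B.lev u) <;> by_cases hv : v ∈ Z (B.lev v)
  · rcases lt_trichotomy (B.lev u) (B.lev v) with h | h | h
    · have e : B.lev v = B.lev u + 1 := by omega
      rw [e] at hv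
      exact hZ' _ _ hv _ hu huv.symm
    · rw [← h] at hv
      exact (hZ _).ind _ hu _ hv huv
    · have e : B.lev u = B.lev v + 1 := by omega
      rw [e] at hu
      exact hZ' _ _ hu _ hv huv
  · simp only [hu, hv, if_true, if_false] at e; omega
  · simp only [hu, hv, if_true, if_false] at e; omega
  · simp only [hu, hv, if_false] at e
    have h : B.lev u = B.lev v := by omega
    refine hf2 (B.lev v) u ⟨h, by rwa [← h]⟩ v ⟨rfl, hv⟩ huv ?_
    rw [h] at e; omega

end FC

namespace FC
open SimpleGraph

variable {V : Type*} {G : SimpleGraph V}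

/-- reachable inside a set -/
def Rch (G : SimpleGraph V) (S : Set V) (x y : V) : Prop := ∃ p : G.Walk x y, ∀ v ∈ p.support, v ∈ S

namespace Rch
variable {S T : Set V} {x y z : V}

theorem refl (h : x ∈ S) : Rch G S x x := ⟨Walk.nil, by simpa⟩

theorem symm (h : Rch G S x y) : Rch G S y x := by
  obtain ⟨p, hp⟩ := h
  exact ⟨p.reverse, by simpa using hp⟩

theorem mono (h : Rch G S x y) (hST : S ⊆ T) : Rch G T x y := by
  obtain ⟨p, hp⟩ := h
  exact ⟨p, fun v hv => hST (hp v hv)⟩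

theorem right (h : Rch G S x y) : y ∈ S := by
  obtain ⟨p, hp⟩ := h
  exact hp _ (by simp)

theorem left (h : Rch G S x y) : x ∈ S := by
  obtain ⟨p, hp⟩ := h
  exact hp _ (by simp)

theorem step (h : Rch G S x y) (ha : G.Adj y z) (hz : z ∈ S) : Rch G S x z := by
  obtain ⟨p, hp⟩ := h
  refine ⟨p.concat ha, fun v hv => ?_⟩
  rw [Walk.support_concat] at hv
  simp at hv
  rcases hv with hv | rfl
  exacts [hp v hv, hz]

theorem toPth (h : Rch G S x y) : ∃ n, Pth G S x y n := by
  classical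
  obtain ⟨p, hp⟩ := h
  exact ⟨p.bypass.length, p.bypass, p.bypass_isPath, rfl, fun v hv => hp v (p.support_bypass_subset_support hv)⟩

/-- induction along a walk -/
theorem ind {P : V → Prop} (h : Rch G S x y) (hx : P x) (hs : ∀ a ∈ S, ∀ b ∈ S, P a → G.Adj a b → P b) : P y := by
  obtain ⟨p, hp⟩ := h
  induction p with
  | nil => exact hx
  | @cons a b c hab p ih =>
    refine ih (hs _ (hp a (by simp)) b (hp b (by simp)) hx hab) (fun v hv => hp v (by simp [hv]))

end Rch

/-- minimal counterexample -/
structure Cr (G : SimpleGraph V) : Prop where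
  nd : ¬ Done G
  ncol : ¬ G.Colorable 5
  edge : ∀ G' < G, G'.Colorable 5
  vert : ∀ S : Set V, S ≠ Set.univ → ∃ f : V → Fin 5, ∀ x ∈ S, ∀ y ∈ S, G.Adj x y → f x ≠ f y

theorem Cr.conn (H : Cr G) {C : Set V} {v x y : V} (hC : C ⊆ {v}) (hx : x ∉ C) (hy : y ∉ C) : Rch G Cᶜ x y := by
  classical
  by_contra hxy
  set A : Set V := {z | Rch G Cᶜ x z} with hA
  have hAC : ∀ z ∈ A, z ∉ C := fun z hz => Rch.right hz
  obtain ⟨f, hf⟩ := H.vert (A ∪ C) (by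
    intro h
    have : y ∈ A ∪ C := h ▸ Set.mem_univ y
    rcases this with h | h
    exacts [hxy h, hy h])
  obtain ⟨g, hg⟩ := H.vert Aᶜ (by
    intro h
    have : x ∈ Aᶜ := h ▸ Set.mem_univ x
    exact this (Rch.refl hx))
  apply H.ncol
  have hcl : ∀ a ∈ A, ∀ b, b ∉ C → G.Adj a b → b ∈ A := fun a ha b hb hab => Rch.step ha hab hb
  have key : ∀ a b, a ∈ A ∪ C → b ∉ A ∪ C → G.Adj a b → f a ≠ Equiv.swap (g v) (f v) (g b) := by
    intro a b ha hb hab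
    simp only [Set.mem_union, not_or] at hb
    rcases ha with ha | ha
    · exact absurd (hcl a ha b hb.2 hab) hb.1
    · have : a = v := hC ha
      subst this
      have h1 := hg a (fun h => hAC a h ha) b hb.1 hab
      intro e
      apply h1
      have := congrArg (Equiv.swap (g a) (f a)) e
      rwa [Equiv.swap_apply_self, Equiv.swap_apply_right] at this
  refine ⟨Coloring.mk (fun z => if z ∈ A ∪ C then f z else Equiv.swap (g v) (f v) (g z)) ?_⟩
  intro a b hab
  by_cases ha : a ∈ A ∪ C <;> by_cases hb : b ∈ A ∪ C
  · simp only [ha, hb, if_true]; exact hf a ha b hb hab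
  · simp only [ha, hb, if_true, if_false]; exact key a b ha hb hab
  · simp only [ha, hb, if_true, if_false]; exact (key b a hb ha hab.symm).symm
  · simp only [ha, hb, if_false]
    simp only [Set.mem_union, not_or] at ha hb
    intro e
    exact hg a ha.1 b hb.1 hab ((Equiv.swap _ _).injective e)

theorem Cr.conn0 (H : Cr G) (x y : V) : Rch G Set.univ x y :=
  (H.conn (C := ∅) (v := x) (by simp) (by simp) (by simp)).mono (by simp)

theorem Cr.conn1 (H : Cr G) {v x y : V} (hx : x ≠ v) (hy : y ≠ v) : Rch G {v}ᶜ x y :=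
  H.conn (C := {v}) subset_rfl (by simpa) (by simpa)

/-- connected set rooted at A -/
def Rt (G : SimpleGraph V) (A S : Set V) : Prop := ∃ a ∈ A, ∀ x ∈ S, Rch G S a x

def DD (G : SimpleGraph V) (A : Set V) (y : V) : Prop :=
  ∃ S1 S2, Disjoint S1 S2 ∧ y ∉ S1 ∧ y ∉ S2 ∧ Rt G A S1 ∧ Rt G A S2 ∧ (∃ z ∈ S1, G.Adj z y) ∧ (∃ z ∈ S2, G.Adj z y)

theorem Cr.E (H : Cr G) {A S1 S2 : Set V} {y x a0 : V} (ha0 : a0 ∈ A) (ha0y : a0 ≠ y) (hd : Disjoint S1 S2) (h1 : y ∉ S1) (h2 : y ∉ S2)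
    (r1 : Rt G A S1) (r2 : Rt G A S2) (hx : x ≠ y) :
    (∃ a ∈ A, Rch G (insert y S2)ᶜ a x) ∨ (∃ a ∈ A, Rch G (insert y S1)ᶜ a x) := by
  have m1 : S1 ⊆ (insert y S2)ᶜ := by
    rintro w hw (rfl | hw')
    exacts [h1 hw, Set.disjoint_left.mp hd hw hw']
  have m2 : S2 ⊆ (insert y S1)ᶜ := by
    rintro w hw (rfl | hw')
    exacts [h2 hw, Set.disjoint_left.mp hd hw' hw]
  have q1 : ∀ w ∈ S1, ∃ a ∈ A, Rch G (insert y S2)ᶜ a w := by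
    intro w hw
    obtain ⟨a, ha, h⟩ := r1
    exact ⟨a, ha, (h w hw).mono m1⟩
  have q2 : ∀ w ∈ S2, ∃ a ∈ A, Rch G (insert y S1)ᶜ a w := by
    intro w hw
    obtain ⟨a, ha, h⟩ := r2
    exact ⟨a, ha, (h w hw).mono m2⟩
  refine (H.conn1 ha0y hx).ind (P := fun x => (∃ a ∈ A, Rch G (insert y S2)ᶜ a x) ∨ (∃ a ∈ A, Rch G (insert y S1)ᶜ a x)) ?_ ?_
  · by_cases h : a0 ∈ S1
    · exact Or.inl (q1 _ h)
    · exact Or.inr ⟨a0, ha0, Rch.refl (by simp [ha0y, h])⟩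
  · intro u _ w hw hu huw
    have hwy : w ≠ y := hw
    by_cases w1 : w ∈ S1
    · exact Or.inl (q1 _ w1)
    by_cases w2 : w ∈ S2
    · exact Or.inr (q2 _ w2)
    rcases hu with ⟨a, ha, h⟩ | ⟨a, ha, h⟩
    · exact Or.inl ⟨a, ha, h.step huw (by simp [hwy, w2])⟩
    · exact Or.inr ⟨a, ha, h.step huw (by simp [hwy, w1])⟩

theorem Rt.of_rch {A S : Set V} {a x : V} (ha : a ∈ A) (h : Rch G S a x) (hx : x ∉ A) :
    ∃ T, T ⊆ S ∧ x ∉ T ∧ Rt G A T ∧ ∃ z ∈ T, G.Adj z x := by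
  obtain ⟨n, p, hp, hn, hS⟩ := h.toPth
  have hn0 : ¬ p.Nil := fun h => hx (h.eq ▸ ha)
  refine ⟨{v | v ∈ p.dropLast.support}, ?_, ?_, ?_, p.penultimate, Walk.end_mem_support _, p.adj_penultimate hn0⟩
  · intro v hv
    exact hS v (by rw [← Walk.support_dropLast_concat hn0]; exact List.mem_append_left _ hv)
  · intro hv
    have h1 := hp.support_nodup
    rw [← Walk.support_dropLast_concat hn0, List.nodup_append] at h1
    exact h1.2.2 x hv x (by simp) rfl
  · refine ⟨a, ha, fun w hw => ?_⟩
    classical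
    exact ⟨p.dropLast.takeUntil w hw, fun v hv => Walk.support_takeUntil_subset_support _ _ hv⟩

end FC

namespace FC
open SimpleGraph

variable {V : Type*} {G : SimpleGraph V}

theorem Cr.dd (H : Cr G) {A : Set V} {a1 a2 : V} (h1 : a1 ∈ A) (h2 : a2 ∈ A) (h12 : a1 ≠ a2) (y : V) : y ∈ A ∨ DD G A y := by
  refine (H.conn0 a1 y).ind (P := fun y => y ∈ A ∨ DD G A y) (Or.inl h1) ?_
  intro y _ y' _ hy hyy
  by_cases hA : y' ∈ A
  · exact Or.inl hA
  right
  obtain ⟨a0, ha0, ha0y⟩ : ∃ a0 ∈ A, a0 ≠ y := by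
    by_cases h : a1 = y
    · exact ⟨a2, h2, fun e => h12 (h.trans e.symm)⟩
    · exact ⟨a1, h1, h⟩
  by_cases hyA : y ∈ A
  · obtain ⟨T, hT, hyT, hR, hz⟩ := Rt.of_rch ha0 (H.conn1 ha0y hyy.ne.symm) hA
    refine ⟨T, {y}, ?_, hyT, ?_, hR, ⟨y, hyA, ?_⟩, hz, ⟨y, rfl, hyy⟩⟩
    · rw [Set.disjoint_right]
      rintro _ rfl h
      exact hT h rfl
    · exact hyy.ne.symm
    · rintro _ rfl
      exact Rch.refl rfl
  have main : ∀ S2 : Set V, y ∉ S2 → Rt G A S2 → (∃ z ∈ S2, G.Adj z y) → (∃ a ∈ A, Rch G (insert y S2)ᶜ a y') → DD G A y' := by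
    rintro S2 hy2 ⟨b, hb, hr⟩ ⟨z, hz, hzy⟩ ⟨a, ha, h⟩
    obtain ⟨T, hT, hyT, hR, hz'⟩ := Rt.of_rch ha h hA
    refine ⟨T, insert y S2, ?_, hyT, h.right, hR, ⟨b, hb, ?_⟩, hz', ⟨y, by simp, hyy⟩⟩
    · rw [Set.disjoint_left]
      intro w hw
      exact hT hw
    · intro w hw
      rcases hw with rfl | hw
      · exact ((hr z hz).mono (Set.subset_insert _ _)).step hzy (by simp)
      · exact (hr w hw).mono (Set.subset_insert _ _)
  obtain ⟨S1, S2, hd, hy1, hy2, r1, r2, z1, z2⟩ := hy.resolve_left hyA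
  rcases H.E ha0 ha0y hd hy1 hy2 r1 r2 hyy.ne.symm with h | h
  · exact main S2 hy2 r2 z2 h
  · exact main S1 hy1 r1 z1 h

/-- two disjoint connections -/
def M2 (G : SimpleGraph V) (A B : Set V) : Prop :=
  ∃ T1 T2 : Set V, Disjoint T1 T2 ∧ (∀ v ∈ A ∩ B, T2 ⊆ {v}) ∧ (∃ a ∈ A, ∃ b ∈ B, Rch G T1 a b) ∧ (∃ a ∈ A, ∃ b ∈ B, Rch G T2 a b)

theorem Cr.m0 (H : Cr G) {A B : Set V} {a1 a2 y1 y2 : V} (h1 : a1 ∈ A) (h2 : a2 ∈ A) (h12 : a1 ≠ a2)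
    (g1 : y1 ∈ B) (g2 : y2 ∈ B) (g12 : y1 ≠ y2) (hAB : Disjoint A B) : M2 G A B := by
  have hyA : y1 ∉ A := fun h => Set.disjoint_left.mp hAB h g1
  obtain ⟨S1, S2, hd, hy1, hy2, r1, r2, z1, z2⟩ := (H.dd h1 h2 h12 y1).resolve_left hyA
  have main : ∀ S2 : Set V, y1 ∉ S2 → Rt G A S2 → (∃ z ∈ S2, G.Adj z y1) → (∃ a ∈ A, Rch G (insert y1 S2)ᶜ a y2) → M2 G A B := by
    rintro S2 hy2 ⟨b, hb, hr⟩ ⟨z, hz, hzy⟩ ⟨a, ha, h⟩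
    refine ⟨_, insert y1 S2, disjoint_compl_left, fun v hv => absurd hv.2 (Set.disjoint_left.mp hAB hv.1), ⟨a, ha, y2, g2, h⟩, ⟨b, hb, y1, g1, ?_⟩⟩
    exact ((hr z hz).mono (Set.subset_insert _ _)).step hzy (by simp)
  rcases H.E h1 (show a1 ≠ y1 from fun e => hyA (e ▸ h1)) hd hy1 hy2 r1 r2 g12.symm with h | h
  · exact main S2 hy2 r2 z2 h
  · exact main S1 hy1 r1 z1 h

theorem Cr.m1 (H : Cr G) {A B : Set V} {v a y : V} (hv : v ∈ A) (hv' : v ∈ B) (h1 : a ∈ A) (h2 : a ≠ v) (g1 : y ∈ B) (g2 : y ≠ v)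
    (hi : A ∩ B ⊆ {v}) :
    M2 G A B :=
  ⟨{v}ᶜ, {v}, disjoint_compl_left, fun w hw => by rw [hi hw], ⟨a, h1, y, g1, H.conn1 h2 g2⟩, ⟨v, hv, v, hv', Rch.refl rfl⟩⟩

/-- trimmed path -/
theorem trim {A B T : Set V} (h : ∃ a ∈ A, ∃ b ∈ B, Rch G T a b) :
    ∃ S ⊆ T, ∃ a ∈ A, ∃ b ∈ B, ∃ n, Pth G S a b n ∧ (∀ x ∈ S, x ∈ A → x = a) ∧ (∀ x ∈ S, x ∈ B → x = b) := by
  classical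
  obtain ⟨a, ha, b, hb, h⟩ := h
  obtain ⟨n, hn⟩ := h.toPth
  have hex : ∃ n, ∃ a ∈ A, ∃ b ∈ B, Pth G T a b n := ⟨n, a, ha, b, hb, hn⟩
  obtain ⟨a, ha, b, hb, p, hp, hl, hS⟩ := Nat.find_spec hex
  have hmin := fun m (hm : m < Nat.find hex) => Nat.find_min hex hm
  refine ⟨{v | v ∈ p.support}, hS, a, ha, b, hb, _, ⟨p, hp, rfl, fun v hv => hv⟩, ?_, ?_⟩
  · intro x hx hxA
    have hx : x ∈ p.support := hx
    have e := congrArg Walk.length (p.take_spec hx)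
    rw [Walk.length_append] at e
    by_contra hne
    have : 0 < (p.takeUntil x hx).length := by
      rw [Nat.pos_iff_ne_zero]
      intro h0
      exact hne (Walk.eq_of_length_eq_zero h0).symm
    exact hmin (p.dropUntil x hx).length (by omega) ⟨x, hxA, b, hb, _, hp.dropUntil hx, rfl, fun v hv => hS v (Walk.support_dropUntil_subset_support _ _ hv)⟩
  · intro x hx hxA
    have hx : x ∈ p.support := hx
    have e := congrArg Walk.length (p.take_spec hx)
    rw [Walk.length_append] at e
    by_contra hne
    have : 0 < (p.dropUntil x hx).length := by
      rw [Nat.pos_iff_ne_zero]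
      intro h0
      exact hne (Walk.eq_of_length_eq_zero h0)
    exact hmin (p.takeUntil x hx).length (by omega) ⟨a, ha, x, hxA, _, hp.takeUntil hx, rfl, fun v hv => hS v (Walk.support_takeUntil_subset_support _ _ hv)⟩

theorem ext2 {S : Set V} {y x y' r s : V} {L : ℕ} (hp : Pth G S y x L) (h0 : G.Adj y' y) (h1 : G.Adj y' r) (h2 : G.Adj y' s)
    (h3 : G.Adj r y) (h4 : G.Adj s r) (hr : r ∉ S) (hs : s ∉ S) (k : ℕ) (hk : k ≤ 2) :
    ∃ z, G.Adj y' z ∧ Pth G (S ∪ {r, s}) z x (L + k) := by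
  have e1 : Pth G ({r} ∪ S) r x (0 + 1 + L) := (Pth.nil (S := {r}) rfl).link h3 hp (by simpa)
  have e2 : Pth G ({s} ∪ ({r} ∪ S)) s x (0 + 1 + (0 + 1 + L)) :=
    (Pth.nil (S := {s}) rfl).link h4 e1 (by simp [hs, h4.ne])
  interval_cases k
  · exact ⟨y, h0, hp.mono Set.subset_union_left⟩
  · refine ⟨r, h1, ?_⟩
    rw [show L + 1 = 0 + 1 + L by omega]
    exact e1.mono (by intro w hw; simp at hw ⊢; tauto)
  · refine ⟨s, h2, ?_⟩
    rw [show L + 2 = 0 + 1 + (0 + 1 + L) by omega]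
    exact e2.mono (by intro w hw; simp at hw ⊢; tauto)

theorem clique_dec [DecidableEq V] {Q : Finset V} (hQ : G.IsNClique 4 Q) {x y : V} (hx : x ∈ Q) (hy : y ∈ Q) (hxy : x ≠ y) :
    ∃ p q, p ∈ Q ∧ q ∈ Q ∧ p ≠ q ∧ p ≠ x ∧ p ≠ y ∧ q ≠ x ∧ q ≠ y := by
  have h : ((Q.erase x).erase y).card = 2 := by
    rw [Finset.card_erase_of_mem (by simp [hy, hxy.symm]), Finset.card_erase_of_mem hx, hQ.card_eq]
  obtain ⟨p, q, hpq, e⟩ := Finset.card_eq_two.mp h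
  have h1 : p ∈ (Q.erase x).erase y := by rw [e]; simp
  have h2 : q ∈ (Q.erase x).erase y := by rw [e]; simp
  simp at h1 h2
  exact ⟨p, q, h1.2.2, h2.2.2, hpq, h1.2.1, h1.1, h2.2.1, h2.1⟩

theorem cl_done (hD : ¬ Done G) {Q Q' : Finset V} (hQ : G.IsNClique 4 Q) (hQ' : G.IsNClique 4 Q')
    (hM : M2 G (Q : Set V) (Q' : Set V)) : False := by
  classical
  obtain ⟨T1, T2, hT, hv, t1, t2⟩ := hM
  obtain ⟨S1, hS1, x1, hx1, y1, hy1, L1, p1, a1, b1⟩ := trim t1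
  obtain ⟨S2, hS2, x2, hx2, y2, hy2, L2, p2, a2, b2⟩ := trim t2
  have hS : Disjoint S1 S2 := hT.mono hS1 hS2
  have hint : ∀ v, v ∈ Q → v ∈ Q' → v = x2 ∧ v = y2 := by
    intro v h h'
    have := hv v ⟨h, h'⟩
    exact ⟨(this (hS2 p2.left)).symm, (this (hS2 p2.right)).symm⟩
  have hx : x1 ≠ x2 := fun e => Set.disjoint_left.mp hS p1.left (e ▸ p2.left)
  have hy : y1 ≠ y2 := fun e => Set.disjoint_left.mp hS p1.right (e ▸ p2.right)
  simp only [Finset.mem_coe] at hx1 hx2 hy1 hy2 a1 a2 b1 b2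
  obtain ⟨p, q, hp, hq, hpq, c1, c2, c3, c4⟩ := clique_dec hQ hx1 hx2 hx
  obtain ⟨r, s, hr, hs, hrs, d1, d2, d3, d4⟩ := clique_dec hQ' hy1 hy2 hy
  have adj : ∀ u ∈ Q, ∀ v ∈ Q, u ≠ v → G.Adj u v := fun u hu v hv h => hQ.isClique hu hv h
  have adj' : ∀ u ∈ Q', ∀ v ∈ Q', u ≠ v → G.Adj u v := fun u hu v hv h => hQ'.isClique hu hv h
  have np1 : p ∉ S1 := fun h => c1 (a1 p h hp)
  have nq1 : q ∉ S1 := fun h => c3 (a1 q h hq)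
  have np2 : p ∉ S2 := fun h => c2 (a2 p h hp)
  have nq2 : q ∉ S2 := fun h => c4 (a2 q h hq)
  have nr1 : r ∉ S1 := fun h => d1 (b1 r h hr)
  have ns1 : s ∉ S1 := fun h => d3 (b1 s h hs)
  have nr2 : r ∉ S2 := fun h => d2 (b2 r h hr)
  have ns2 : s ∉ S2 := fun h => d4 (b2 s h hs)
  have pr : p ≠ r := fun e => c2 (hint p hp (e ▸ hr)).1
  have ps : p ≠ s := fun e => c2 (hint p hp (e ▸ hs)).1
  have qr : q ≠ r := fun e => c4 (hint q hq (e ▸ hr)).1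
  have qs : q ≠ s := fun e => c4 (hint q hq (e ▸ hs)).1
  have key : ∀ j ≤ 2, ∀ k ≤ 2, 1 ≤ L1 + L2 + j + k → HasCycleLength G (L1 + L2 + j + k + 2) := by
    intro j hj k hk h1
    obtain ⟨z, hz, e1⟩ := ext2 p2.symm (adj' _ hy1 _ hy2 hy) (adj' _ hy1 _ hr d1.symm) (adj' _ hy1 _ hs d3.symm)
      (adj' _ hr _ hy2 d2) (adj' _ hs _ hr hrs.symm) nr2 ns2 k hk
    obtain ⟨w, hw, e2⟩ := ext2 p1 (adj _ hx2 _ hx1 hx.symm) (adj _ hx2 _ hp c2.symm) (adj _ hx2 _ hq c4.symm)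
      (adj _ hp _ hx1 c1) (adj _ hq _ hp hpq.symm) np1 nq1 j hj
    have hd : Disjoint (S1 ∪ {p, q}) (S2 ∪ {r, s}) := by
      rw [Set.disjoint_left] at hS ⊢
      intro w h1 h2
      simp only [Set.mem_union, Set.mem_insert_iff, Set.mem_singleton_iff] at h1 h2
      rcases h1 with h1 | rfl | rfl <;> rcases h2 with h2 | rfl | rfl
      · exact hS h1 h2
      all_goals contradiction
    exact cyc_congr ((e2.link hz e1 hd).cyc hw (by omega)) (by omega)
  have hL : 1 ≤ L1 + L2 := by
    by_contra h0
    have e1 : L1 = 0 := by omega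
    have e2 : L2 = 0 := by omega
    subst e1 e2
    obtain ⟨w, _, hw, _⟩ := p1
    have := Walk.eq_of_length_eq_zero hw
    exact hx (hint x1 hx1 (this ▸ hy1)).1
  rcases Nat.even_or_odd' (L1 + L2) with ⟨c, hc | hc⟩
  · refine nd4 hD (L1 + L2 + 3) (by omega) ?_ ?_ ?_ ?_
    · exact cyc_congr (key 1 (by omega) 0 (by omega) (by omega)) (by omega)
    · exact cyc_congr (key 2 (by omega) 0 (by omega) (by omega)) (by omega)
    · exact cyc_congr (key 2 (by omega) 1 (by omega) (by omega)) (by omega)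
    · exact cyc_congr (key 2 (by omega) 2 (by omega) (by omega)) (by omega)
  · refine nd4 hD (L1 + L2 + 2) (by omega) ?_ ?_ ?_ ?_
    · exact cyc_congr (key 0 (by omega) 0 (by omega) (by omega)) (by omega)
    · exact cyc_congr (key 1 (by omega) 0 (by omega) (by omega)) (by omega)
    · exact cyc_congr (key 2 (by omega) 0 (by omega) (by omega)) (by omega)
    · exact cyc_congr (key 2 (by omega) 1 (by omega) (by omega)) (by omega)

/-- two 4-cliques share three vertices -/
theorem Cr.share (H : Cr G) [DecidableEq V] {Q Q' : Finset V} (hQ : G.IsNClique 4 Q) (hQ' : G.IsNClique 4 Q') : 3 ≤ (Q ∩ Q').card := by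
  by_contra hlt
  have hc : (Q ∩ Q').card = 0 ∨ (Q ∩ Q').card = 1 ∨ (Q ∩ Q').card = 2 := by omega
  rcases hc with hc | hc | hc
  · obtain ⟨a, b, hab, _⟩ := Finset.one_lt_card_iff.mp (show 1 < Q.card by rw [hQ.card_eq]; omega)
    obtain ⟨a', b', hab', _⟩ := Finset.one_lt_card_iff.mp (show 1 < Q'.card by rw [hQ'.card_eq]; omega)
    refine cl_done H.nd hQ hQ' (H.m0 (a1 := a) (a2 := b) (y1 := a') (y2 := b') ?_ ?_ ?_ ?_ ?_ ?_ ?_)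
    all_goals first | (simp; tauto) | skip
    rw [Finset.disjoint_coe, Finset.disjoint_iff_inter_eq_empty]
    exact Finset.card_eq_zero.mp hc
  · obtain ⟨v, hv⟩ := Finset.card_eq_one.mp hc
    have hv1 : v ∈ Q ∩ Q' := by rw [hv]; simp
    rw [Finset.mem_inter] at hv1
    obtain ⟨a, ha, hav⟩ := Finset.exists_mem_ne (show 1 < Q.card by rw [hQ.card_eq]; omega) v
    obtain ⟨b, hb, hbv⟩ := Finset.exists_mem_ne (show 1 < Q'.card by rw [hQ'.card_eq]; omega) v
    refine cl_done H.nd hQ hQ' (H.m1 (v := v) hv1.1 hv1.2 ha hav hb hbv ?_)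
    rw [← Finset.coe_inter, hv]; simp
  · obtain ⟨u, v, huv, e⟩ := Finset.card_eq_two.mp hc
    have hu1 : u ∈ Q ∩ Q' := by rw [e]; simp
    have hv1 : v ∈ Q ∩ Q' := by rw [e]; simp
    rw [Finset.mem_inter] at hv1 hu1
    obtain ⟨p, q, hp, hq, hpq, c1, c2, c3, c4⟩ := clique_dec hQ hu1.1 hv1.1 huv
    obtain ⟨r, s, hr, hs, hrs, d1, d2, d3, d4⟩ := clique_dec hQ' hu1.2 hv1.2 huv
    have hint : ∀ w, w ∈ Q → w ∈ Q' → w = u ∨ w = v := by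
      intro w h h'
      have : w ∈ Q ∩ Q' := Finset.mem_inter.mpr ⟨h, h'⟩
      rw [e] at this
      simpa using this
    have adj : ∀ u ∈ Q, ∀ v ∈ Q, u ≠ v → G.Adj u v := fun u hu v hv h => hQ.isClique hu hv h
    have adj' : ∀ u ∈ Q', ∀ v ∈ Q', u ≠ v → G.Adj u v := fun u hu v hv h => hQ'.isClique hu hv h
    have pr : p ≠ r := fun e => by rcases hint p hp (e ▸ hr) with h | h <;> contradiction
    have ps : p ≠ s := fun e => by rcases hint p hp (e ▸ hs) with h | h <;> contradiction
    have qr : q ≠ r := fun e => by rcases hint q hq (e ▸ hr) with h | h <;> contradiction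
    have qs : q ≠ s := fun e => by rcases hint q hq (e ▸ hs) with h | h <;> contradiction
    have f1 := adj _ hu1.1 _ hv1.1 huv
    have f2 := adj _ hu1.1 _ hp c1.symm
    have f3 := adj _ hp _ hq hpq
    have f4 := adj _ hq _ hv1.1 c4
    have f4' := adj _ hp _ hv1.1 c2
    have g2 := adj' _ hu1.2 _ hr d1.symm
    have g3 := adj' _ hr _ hs hrs
    have g4 := adj' _ hs _ hv1.2 d4
    have g4' := adj' _ hr _ hv1.2 d2
    have k3 : HasCycleLength G 3 := cyc_list [p, v] u
    have k4 : HasCycleLength G 4 := cyc_list [p, q, v] u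
    have k5 : HasCycleLength G 5 := cyc_list [p, q, v, r] u
    have k6 : HasCycleLength G 6 := cyc_list [p, q, v, s, r] u
    exact nd4 H.nd 3 (by omega) k3 k4 k5 k6

end FC

namespace FC
open SimpleGraph

variable {V : Type*} {G : SimpleGraph V}

theorem par_walk {f : V → Fin 5} {α κ : Fin 5} (hf : ∀ x y, G.Adj x y → f x ≠ f y) {x y : V} (p : G.Walk x y)
    (hp : ∀ v ∈ p.support, f v = α ∨ f v = κ) : p.length % 2 = 0 ↔ f x = f y := by
  induction p with
  | nil => simp
  | @cons u v w h p ih =>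
    have ih := ih (fun v hv => hp v (by simp [hv]))
    have h1 := hp u (by simp)
    have h2 := hp v (by simp)
    have h3 := hp w (by simp)
    have h4 := hf _ _ h
    rw [Walk.length_cons]
    have : (p.length + 1) % 2 = 0 ↔ ¬ (p.length % 2 = 0) := by omega
    rw [this, ih]
    grind

theorem Pth.le {G' : SimpleGraph V} (h : G' ≤ G) {S : Set V} {x y : V} {n : ℕ} (hp : Pth G' S x y n) : Pth G S x y n := by
  obtain ⟨p, h1, h2, h3⟩ := hp
  exact ⟨p.mapLe h, h1.mapLe h, by simpa using h2, by simpa using h3⟩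

theorem Cr.noK5 (H : Cr G) {a b c d e : V} (ab : G.Adj a b) (ac : G.Adj a c) (ad : G.Adj a d) (ae : G.Adj a e)
    (bc : G.Adj b c) (bd : G.Adj b d) (be : G.Adj b e) (cd : G.Adj c d) (ce : G.Adj c e) (de : G.Adj d e) : False := by
  classical
  have l1 : Pth G {c, d, e} c c 0 := Pth.nil (by simp)
  have l2 : Pth G {c, d, e} c d 1 := pth_list [d] c d
  have l3 : Pth G {c, d, e} c e 2 := pth_list [d, e] c e
  set G' := G.deleteEdges {s(a, b)} with hG'
  have hle : G' ≤ G := G.deleteEdges_le _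
  have adj' : ∀ x y, G'.Adj x y ↔ G.Adj x y ∧ ¬ (s(x, y) = s(a, b)) := by
    intro x y; rw [hG', deleteEdges_adj]; simp
  have hlt : G' < G := lt_of_le_of_ne hle (by
    intro h
    have : G'.Adj a b := h ▸ ab
    rw [adj'] at this
    exact this.2 rfl)
  obtain ⟨C⟩ := H.edge G' hlt
  have hC : ∀ x y, G'.Adj x y → C x ≠ C y := fun x y h => C.valid h
  set f : V → Fin 5 := fun x => C x with hf
  have hfx : ∀ x y, G'.Adj x y → f x ≠ f y := hC
  have key : ∀ x y, G.Adj x y → f x ≠ f y ∨ (x = a ∧ y = b) ∨ (x = b ∧ y = a) := by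
    intro x y h
    by_cases h' : s(x, y) = s(a, b)
    · right; simpa using h'
    · left; exact hfx x y ((adj' x y).mpr ⟨h, h'⟩)
  have fab : f a = f b := by
    by_contra hne
    apply H.ncol
    refine ⟨Coloring.mk f ?_⟩
    intro x y h
    rcases key x y h with h | ⟨rfl, rfl⟩ | ⟨rfl, rfl⟩
    · exact h
    · exact hne
    · exact fun e => hne e.symm
  have nac := ac.ne
  have nad := ad.ne
  have nae := ae.ne
  have nbc := bc.ne
  have nbd := bd.ne
  have nbe := be.ne
  have fac : f a ≠ f c := by rcases key a c ac with h | h | h <;> grind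
  have fad : f a ≠ f d := by rcases key a d ad with h | h | h <;> grind
  have fae : f a ≠ f e := by rcases key a e ae with h | h | h <;> grind
  have fcd : f c ≠ f d := by rcases key c d cd with h | h | h <;> grind
  have fce : f c ≠ f e := by rcases key c e ce with h | h | h <;> grind
  have fde : f d ≠ f e := by rcases key d e de with h | h | h <;> grind
  obtain ⟨κ, hκ⟩ : ∃ κ : Fin 5, κ ∉ ({f a, f c, f d, f e} : Finset (Fin 5)) := by
    by_contra h
    push Not at h
    have h1 : (Finset.univ : Finset (Fin 5)).card ≤ ({f a, f c, f d, f e} : Finset (Fin 5)).card :=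
      Finset.card_le_card (fun x _ => h x)
    have h2 := Finset.card_le_four (a := f a) (b := f c) (c := f d) (d := f e)
    simp at h1
    omega
  simp only [Finset.mem_insert, Finset.mem_singleton, not_or] at hκ
  obtain ⟨ka, kc, kd, ke⟩ := hκ
  set S : Set V := {x | f x = f a ∨ f x = κ} with hS
  have haS : a ∈ S := Or.inl rfl
  have hbS : b ∈ S := Or.inl fab.symm
  have hR : Rch G' S a b := by
    by_contra hR
    apply H.ncol
    let g : V → Fin 5 := fun x => if Rch G' S a x then (if f x = f a then κ else f a) else f x
    have hg1 : ∀ x, Rch G' S a x → g x = if f x = f a then κ else f a := fun x hx => if_pos hx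
    have hg0 : ∀ x, ¬ Rch G' S a x → g x = f x := fun x hx => if_neg hx
    have mix : ∀ x y, G'.Adj x y → Rch G' S a x → ¬ Rch G' S a y → g x ≠ g y := by
      intro x y h hx hy
      have hyS : ¬ (f y = f a ∨ f y = κ) := fun hh => hy (hx.step h hh)
      rw [hg1 x hx, hg0 y hy]
      grind
    have pr : ∀ x y, G'.Adj x y → g x ≠ g y := by
      intro x y h
      by_cases hx : Rch G' S a x <;> by_cases hy : Rch G' S a y
      · have h1 : f x = f a ∨ f x = κ := hx.right
        have h2 : f y = f a ∨ f y = κ := hy.right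
        have := hfx x y h
        rw [hg1 x hx, hg1 y hy]
        grind
      · exact mix x y h hx hy
      · exact (mix y x h.symm hy hx).symm
      · rw [hg0 x hx, hg0 y hy]; exact hfx x y h
    have gab : g a ≠ g b := by
      rw [hg1 a (Rch.refl haS), hg0 b hR, if_pos rfl, ← fab]; exact ka
    refine ⟨Coloring.mk g ?_⟩
    intro x y h
    by_cases h' : s(x, y) = s(a, b)
    · rcases (by simpa using h' : (x = a ∧ y = b) ∨ (x = b ∧ y = a)) with ⟨rfl, rfl⟩ | ⟨rfl, rfl⟩
      · exact gab
      · exact gab.symm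
    · exact pr x y ((adj' x y).mpr ⟨h, h'⟩)
  obtain ⟨n, hn⟩ := hR.toPth
  have hpar : n % 2 = 0 := by
    obtain ⟨p, _, rfl, h3⟩ := hn
    exact (par_walk hfx p h3).mpr fab
  have hn0 : n ≠ 0 := by
    rintro rfl
    obtain ⟨p, _, h, _⟩ := hn
    exact ab.ne (Walk.eq_of_length_eq_zero h)
  have P : Pth G S a b n := hn.le hle
  have hd : Disjoint S {c, d, e} := by
    rw [Set.disjoint_right]
    intro x hx h
    have h : f x = f a ∨ f x = κ := h
    simp only [Set.mem_insert_iff, Set.mem_singleton_iff] at hx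
    rcases hx with rfl | rfl | rfl <;> grind
  refine nd4 H.nd (n + 1) (by omega) ?_ ?_ ?_ ?_
  · exact P.cyc ab.symm (by omega)
  · exact cyc_congr ((P.link bc l1 hd).cyc ac.symm (by omega)) (by omega)
  · exact cyc_congr ((P.link bc l2 hd).cyc ad.symm (by omega)) (by omega)
  · exact cyc_congr ((P.link bc l3 hd).cyc ae.symm (by omega)) (by omega)

theorem Cr.hit (H : Cr G) [Nonempty V] : ∃ x, ∀ Q : Finset V, G.IsNClique 4 Q → x ∈ Q := by
  classical
  by_contra hno
  push Not at hno
  obtain ⟨Q0, hQ0, _⟩ := hno (Classical.arbitrary V)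
  obtain ⟨a, b, ha, hb, hab⟩ := Finset.one_lt_card_iff.mp (show 1 < Q0.card by rw [hQ0.card_eq]; omega)
  obtain ⟨Qa, hQa, haQ⟩ := hno a
  obtain ⟨Qb, hQb, hbQ⟩ := hno b
  obtain ⟨c, d, hc, hd, hcd, ca, cb, da, db⟩ := clique_dec hQ0 ha hb hab
  have sub : ∀ (Q : Finset V) (u : V), G.IsNClique 4 Q → u ∈ Q0 → u ∉ Q → ∀ v ∈ Q0, v ≠ u → v ∈ Q := by
    intro Q u hQ hu huQ v hv hvu
    have h1 : Q0 ∩ Q ⊆ Q0.erase u := by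
      intro w hw
      rw [Finset.mem_inter] at hw
      rw [Finset.mem_erase]
      exact ⟨fun e => huQ (e ▸ hw.2), hw.1⟩
    have h2 := H.share hQ0 hQ
    have h3 : Q0 ∩ Q = Q0.erase u := Finset.eq_of_subset_of_card_le h1 (by
      rw [Finset.card_erase_of_mem hu, hQ0.card_eq]; omega)
    have : v ∈ Q0 ∩ Q := by rw [h3]; simp [hv, hvu]
    exact (Finset.mem_inter.mp this).2
  obtain ⟨e, he, he0⟩ : ∃ e ∈ Qa ∩ Qb, e ∉ Q0 := by
    by_contra h
    push Not at h
    have h1 : Qa ∩ Qb ⊆ (Q0.erase a).erase b := by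
      intro w hw
      have := h w hw
      rw [Finset.mem_inter] at hw
      rw [Finset.mem_erase, Finset.mem_erase]
      exact ⟨fun e => hbQ (e ▸ hw.2), fun e => haQ (e ▸ hw.1), this⟩
    have h2 := Finset.card_le_card h1
    have h3 := H.share hQa hQb
    rw [Finset.card_erase_of_mem (by simp [hb, hab.symm]), Finset.card_erase_of_mem ha, hQ0.card_eq] at h2
    omega
  rw [Finset.mem_inter] at he
  have ne0 : ∀ v ∈ Q0, v ≠ e := fun v hv h => he0 (h ▸ hv)
  have adj : ∀ u ∈ Q0, ∀ v ∈ Q0, u ≠ v → G.Adj u v := fun u hu v hv h => hQ0.isClique hu hv h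
  have ade : ∀ v ∈ Q0, v ≠ a → G.Adj v e := fun v hv hva => hQa.isClique (sub Qa a hQa ha haQ v hv hva) he.1 (ne0 v hv)
  have aae : G.Adj a e := hQb.isClique (sub Qb b hQb hb hbQ a ha hab) he.2 (ne0 a ha)
  exact H.noK5 (adj a ha b hb hab) (adj a ha c hc ca.symm) (adj a ha d hd da.symm) aae (adj b hb c hc cb.symm)
    (adj b hb d hd db.symm) (ade b hb hab.symm) (adj c hc d hd hcd) (ade c hc ca) (ade d hd da)

theorem exists_bfs (hc : G.Connected) (x : V) : ∃ B : BFS G, B.lev x = 0 := by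
  classical
  have hpar : ∀ v, ∃ w, 0 < G.dist v x → G.Adj v w ∧ G.dist w x + 1 = G.dist v x := by
    intro v
    obtain ⟨p, hp⟩ := (hc v x).exists_walk_length_eq_dist
    cases p with
    | nil => exact ⟨x, by simp⟩
    | @cons _ w _ h q =>
      refine ⟨w, fun _ => ⟨h, ?_⟩⟩
      have h1 := dist_le q
      have h2 := hc.dist_triangle (u := v) (v := w) (w := x)
      rw [Walk.length_cons] at hp
      have h3 : G.dist v w = 1 := dist_eq_one_iff_adj.mpr h
      omega
  choose par hpar using hpar
  refine ⟨{ lev := fun v => G.dist v x, par := par, par_adj := fun v hv => (hpar v hv).1, par_lev := fun v hv => (hpar v hv).2, root := ?_, adj_lev := ?_ }, ?_⟩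
  · intro u v hu hv
    rw [hc.dist_eq_zero_iff] at hu hv
    exact hu.trans hv.symm
  · intro u v h
    have h2 := hc.dist_triangle (u := u) (v := v) (w := x)
    have h3 : G.dist u v = 1 := dist_eq_one_iff_adj.mpr h
    omega
  · exact dist_self

theorem Cr.false [Finite V] (H : Cr G) : False := by
  classical
  have hne : Nonempty V := by
    by_contra h
    rw [not_nonempty_iff] at h
    exact H.ncol (Colorable.of_isEmpty _)
  obtain ⟨x, hx⟩ := H.hit
  have hc : G.Connected := by
    exact ⟨fun u v => by obtain ⟨p, _⟩ := H.conn0 u v; exact ⟨p⟩⟩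
  obtain ⟨B, hB⟩ := exists_bfs hc x
  apply H.ncol
  refine col5 (B := B) H.nd ?_
  intro a b c d la lb lc ld ab ac ad bc bd cd
  have hq : G.IsNClique 4 {a, b, c, d} := by
    have n1 := ab.ne
    have n2 := ac.ne
    have n3 := ad.ne
    have n4 := bc.ne
    have n5 := bd.ne
    have n6 := cd.ne
    rw [isNClique_iff]
    constructor
    · simp [isClique_iff, Set.pairwise_insert, ab, ac, ad, bc, bd, cd, ab.symm, ac.symm, ad.symm, bc.symm, bd.symm, cd.symm]
    · simp [n1, n2, n3, n4, n5, n6]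
  have := hx _ hq
  simp only [Finset.mem_insert, Finset.mem_singleton] at this
  rcases this with rfl | rfl | rfl | rfl <;> omega

theorem Done.le {G' : SimpleGraph V} (h : G' ≤ G) (hD : Done G') : Done G := by
  obtain ⟨m, hm, h1⟩ := hD
  refine ⟨m, hm, fun i hi => ?_⟩
  obtain ⟨u, c, hc, hl⟩ := h1 i hi
  exact ⟨u, c.mapLe h, hc.mapLe h, by simpa using hl⟩

theorem Done.induce {S : Set V} (hD : Done (G.induce S)) : Done G := by
  obtain ⟨m, hm, h1⟩ := hD
  refine ⟨m, hm, fun i hi => ?_⟩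
  obtain ⟨u, c, hc, hl⟩ := h1 i hi
  exact ⟨_, c.map (Embedding.induce S).toHom, hc.map (Embedding.induce (G := G) S).injective, by rw [Walk.length_map]; exact hl⟩

theorem col_all (n : ℕ) : ∀ {V : Type*} [Finite V] (G : SimpleGraph V), Nat.card V = n → ¬ Done G → G.Colorable 5 := by
  induction n using Nat.strong_induction_on with
  | _ n ih =>
  intro V _ G hn hD
  by_contra hcol
  obtain ⟨G0, hG0, hmin⟩ := exists_minimal_le_of_wellFoundedLT (fun G' : SimpleGraph V => ¬ G'.Colorable 5) G hcol
  have hD0 : ¬ Done G0 := fun h => hD (h.le hG0)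
  refine Cr.false (G := G0) ⟨hD0, hmin.1, ?_, ?_⟩
  · intro G' hlt
    by_contra h
    exact absurd (hmin.2 h hlt.le) hlt.not_ge
  · intro S hS
    classical
    obtain ⟨C⟩ := ih (Nat.card S) (by
      rw [← hn, Nat.card_coe_set_eq, ← Set.ncard_univ]
      exact Set.ncard_lt_ncard (Set.ssubset_univ_iff.mpr hS)) (G0.induce S) rfl (fun h => hD0 h.induce)
    refine ⟨fun x => if h : x ∈ S then C ⟨x, h⟩ else 0, ?_⟩
    intro x hx y hy hxy
    simp only [hx, hy, dif_pos]
    exact C.valid (by simpa using hxy)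

end FC

/-- Every graph of chromatic number six contains four cycles of consecutive lengths
`2m + 1, 2m + 2, 2m + 3, 2m + 4`, starting with an odd number. -/
theorem stmt_12 {V : Type*} [Fintype V] (G : SimpleGraph V)
    (hchrom : G.chromaticNumber = 6) :
    ∃ m : ℕ, 0 < m ∧ ∀ i < 4, HasCycleLength G (2 * m + 1 + i) := by
  by_contra hD
  have h := (FC.col_all _ G rfl hD).chromaticNumber_le
  rw [hchrom] at h
  exact absurd h (by decide)
end

section
/- Let k ≥ 3 and m ≥ 2k be integers, and let G_{k,m} be the graph constructed as follows: take the complete bipartite graph K_{k−1,m} with parts X and Y, where |X| = k−1 and Y = Y_1 ∪ Y_2 is a partition of Y with |Y_1| ≥ k and |Y_2| ≥ k; add two new vertices x_1, x_2 and all edges in {x_1x_2} ∪ {x_1u : u ∈ Y_1} ∪ {x_2v : v ∈ Y_2}. Then G_{k,m} is a 2-connected K_3-free graph of minimum degree at least k, G_{k,m} contains a cycle of length 2k+2, and G_{k,m} contains no cycle of length greater than 2k+2. -/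
/-- A finite graph is 2-connected: it has at least 3 vertices and remains connected after
deleting any single vertex. -/
def TwoConnected {V : Type*} [Fintype V] (G : SimpleGraph V) : Prop :=
  3 ≤ Fintype.card V ∧ ∀ v : V, (G.induce ({v}ᶜ : Set V)).Connected

/-- `Ggraph k m₁ m₂` : take the complete bipartite graph with parts `X = Fin (k-1)` and
`Y = Y₁ ∪ Y₂` (where `Y₁ = Fin m₁`, `Y₂ = Fin m₂`), and add two new vertices `x₁, x₂`
(the two elements of `Fin 2`), joining `x₁` to `x₂`, `x₁` to every vertex of `Y₁` and
`x₂` to every vertex of `Y₂`. -/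
def Ggraph (k m₁ m₂ : ℕ) : SimpleGraph (Fin (k - 1) ⊕ ((Fin m₁ ⊕ Fin m₂) ⊕ Fin 2)) :=
  SimpleGraph.fromRel fun u v =>
    match u, v with
    | Sum.inl _, Sum.inr (Sum.inl _) => True          -- edges between X and Y
    | Sum.inr (Sum.inl (Sum.inl _)), Sum.inr (Sum.inr x) => x = 0  -- x₁ joined to Y₁
    | Sum.inr (Sum.inl (Sum.inr _)), Sum.inr (Sum.inr x) => x = 1  -- x₂ joined to Y₂
    | Sum.inr (Sum.inr _), Sum.inr (Sum.inr _) => True             -- the edge x₁x₂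
    | _, _ => False

section helpers
variable {k m₁ m₂ : ℕ}

theorem gg_XY (a : Fin (k-1)) (y : Fin m₁ ⊕ Fin m₂) :
    (Ggraph k m₁ m₂).Adj (Sum.inl a) (Sum.inr (Sum.inl y)) := by
  simp [Ggraph]

theorem gg_Y1 (y : Fin m₁) :
    (Ggraph k m₁ m₂).Adj (Sum.inr (Sum.inl (Sum.inl y))) (Sum.inr (Sum.inr 0)) := by
  simp [Ggraph]

theorem gg_Y2 (y : Fin m₂) :
    (Ggraph k m₁ m₂).Adj (Sum.inr (Sum.inl (Sum.inr y))) (Sum.inr (Sum.inr 1)) := by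
  simp [Ggraph]

theorem gg_YY (y y' : Fin m₁ ⊕ Fin m₂) :
    ¬ (Ggraph k m₁ m₂).Adj (Sum.inr (Sum.inl y)) (Sum.inr (Sum.inl y')) := by
  rcases y with y | y <;> rcases y' with y' | y' <;> simp [Ggraph]

theorem gg_cliqueFree : (Ggraph k m₁ m₂).CliqueFree 3 := by
  intro s hs
  obtain ⟨a, b, c, hab, hac, hbc, rfl⟩ := SimpleGraph.is3Clique_iff.1 hs
  rcases a with a | (a | a) | a <;> rcases b with b | (b | b) | b <;>
    rcases c with c | (c | c) | c <;> simp [Ggraph] at hab hac hbc <;> first | omega | grind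

theorem gg_two (hk : 3 ≤ k) (h1 : k ≤ m₁) (h2 : k ≤ m₂) : TwoConnected (Ggraph k m₁ m₂) := by
  refine ⟨by simp; omega, fun v => ?_⟩
  obtain ⟨x, hx⟩ : ∃ x : Fin (k-1), (Sum.inl x : Fin (k - 1) ⊕ ((Fin m₁ ⊕ Fin m₂) ⊕ Fin 2)) ≠ v := by
    by_contra! h
    have := (h ⟨0, by omega⟩).trans (h ⟨1, by omega⟩).symm
    simp at this
  obtain ⟨y1, hy1⟩ : ∃ x : Fin m₁, (Sum.inr (Sum.inl (Sum.inl x)) : Fin (k - 1) ⊕ ((Fin m₁ ⊕ Fin m₂) ⊕ Fin 2)) ≠ v := by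
    by_contra! h
    have := (h ⟨0, by omega⟩).trans (h ⟨1, by omega⟩).symm
    simp at this
  obtain ⟨y2, hy2⟩ : ∃ x : Fin m₂, (Sum.inr (Sum.inl (Sum.inr x)) : Fin (k - 1) ⊕ ((Fin m₁ ⊕ Fin m₂) ⊕ Fin 2)) ≠ v := by
    by_contra! h
    have := (h ⟨0, by omega⟩).trans (h ⟨1, by omega⟩).symm
    simp at this
  have hY : ∀ (y : Fin m₁ ⊕ Fin m₂) (hy : Sum.inr (Sum.inl y) ≠ v),
      ((Ggraph k m₁ m₂).induce ({v}ᶜ : Set _)).Reachable ⟨Sum.inl x, hx⟩ ⟨Sum.inr (Sum.inl y), hy⟩ := by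
    intro y hy
    apply SimpleGraph.Adj.reachable
    simpa using gg_XY x y
  have hN : ∀ w (hw : w ≠ v) (y : Fin m₁ ⊕ Fin m₂) (hy : Sum.inr (Sum.inl y) ≠ v),
      (Ggraph k m₁ m₂).Adj (Sum.inr (Sum.inl y)) w →
      ((Ggraph k m₁ m₂).induce ({v}ᶜ : Set _)).Reachable ⟨Sum.inl x, hx⟩ ⟨w, hw⟩ := by
    intro w hw y hy h
    refine (hY y hy).trans (SimpleGraph.Adj.reachable ?_)
    simpa using h
  rw [SimpleGraph.connected_iff_exists_forall_reachable]
  refine ⟨⟨Sum.inl x, hx⟩, ?_⟩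
  rintro ⟨w, hw⟩
  rcases w with a | y | a
  · exact hN _ hw _ hy1 (gg_XY _ _).symm
  · exact hY _ hw
  · fin_cases a
    · exact hN _ hw _ hy1 (gg_Y1 _)
    · exact hN _ hw _ hy2 (gg_Y2 _)

theorem le_ncard_aux {V : Type*} [Finite V] (S : Set V) (k : ℕ) (f : Fin k → V)
    (hf : Function.Injective f) (h : ∀ i, f i ∈ S) : k ≤ S.ncard := by
  have h1 : (Set.range f).ncard ≤ S.ncard :=
    Set.ncard_le_ncard (by rintro _ ⟨i, rfl⟩; exact h i) (Set.toFinite _)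
  rw [Set.ncard_range_of_injective hf] at h1
  simpa using h1

theorem gg_deg (hk : 3 ≤ k) (h1 : k ≤ m₁) (h2 : k ≤ m₂) (v) :
    k ≤ ((Ggraph k m₁ m₂).neighborSet v).ncard := by
  rcases v with a | (y | y) | a
  · refine le_ncard_aux _ k (fun i => Sum.inr (Sum.inl (Sum.inl ⟨i, by omega⟩))) ?_ ?_
    · intro i j h; simpa [Fin.ext_iff] using h
    · intro i; exact gg_XY _ _
  · refine le_ncard_aux _ k (fun i => if h : (i : ℕ) < k - 1 then Sum.inl ⟨i, h⟩
      else Sum.inr (Sum.inr 0)) ?_ ?_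
    · intro i j h
      have := i.2
      have := j.2
      simp only at h
      split_ifs at h <;> simp [Fin.ext_iff] at h ⊢ <;> omega
    · intro i
      split_ifs
      · exact (gg_XY _ _).symm
      · exact gg_Y1 _
  · refine le_ncard_aux _ k (fun i => if h : (i : ℕ) < k - 1 then Sum.inl ⟨i, h⟩
      else Sum.inr (Sum.inr 1)) ?_ ?_
    · intro i j h
      have := i.2
      have := j.2
      simp only at h
      split_ifs at h <;> simp [Fin.ext_iff] at h ⊢ <;> omega
    · intro i
      split_ifs
      · exact (gg_XY _ _).symm
      · exact gg_Y2 _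
  · fin_cases a
    · refine le_ncard_aux _ k (fun i => Sum.inr (Sum.inl (Sum.inl ⟨i, by omega⟩))) ?_ ?_
      · intro i j h; simpa [Fin.ext_iff] using h
      · intro i; exact (gg_Y1 _).symm
    · refine le_ncard_aux _ k (fun i => Sum.inr (Sum.inl (Sum.inr ⟨i, by omega⟩))) ?_ ?_
      · intro i j h; simpa [Fin.ext_iff] using h
      · intro i; exact (gg_Y2 _).symm

def ggf (hk : 3 ≤ k) (h1 : k ≤ m₁) (h2 : k ≤ m₂) (i : Fin (2 * k + 2)) :
    Fin (k - 1) ⊕ ((Fin m₁ ⊕ Fin m₂) ⊕ Fin 2) :=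
  if (i : ℕ) = 0 then Sum.inr (Sum.inr 0)
  else if (i : ℕ) = 1 then Sum.inr (Sum.inl (Sum.inl ⟨0, by omega⟩))
  else if (i : ℕ) = 2 then Sum.inl ⟨0, by omega⟩
  else if (i : ℕ) = 3 then Sum.inr (Sum.inl (Sum.inr ⟨0, by omega⟩))
  else if (i : ℕ) = 4 then Sum.inr (Sum.inr 1)
  else if (i : ℕ) = 5 then Sum.inr (Sum.inl (Sum.inr ⟨1, by omega⟩))
  else if (i : ℕ) % 2 = 0 then Sum.inl ⟨(i : ℕ) / 2 - 2, by omega⟩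
  else Sum.inr (Sum.inl (Sum.inl ⟨(i : ℕ) / 2 - 2, by omega⟩))

set_option maxHeartbeats 4000000 in
theorem ggf_inj (hk : 3 ≤ k) (h1 : k ≤ m₁) (h2 : k ≤ m₂) :
    Function.Injective (ggf hk h1 h2) := by
  intro i j h
  rw [Fin.ext_iff]
  unfold ggf at h
  split_ifs at h <;> simp [Fin.ext_iff] at h <;> omega

set_option maxHeartbeats 4000000 in
theorem ggf_adj (hk : 3 ≤ k) (h1 : k ≤ m₁) (h2 : k ≤ m₂) (i j : Fin (2 * k + 2))
    (h : (j : ℕ) = i + 1 ∨ ((i : ℕ) = 2 * k + 1 ∧ (j : ℕ) = 0)) :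
    (Ggraph k m₁ m₂).Adj (ggf hk h1 h2 i) (ggf hk h1 h2 j) := by
  unfold ggf
  split_ifs <;> first
    | (exfalso; omega) | exact gg_XY _ _ | exact (gg_XY _ _).symm | exact gg_Y1 _
    | exact (gg_Y1 _).symm | exact gg_Y2 _ | exact (gg_Y2 _).symm

theorem fin_sub_one {n : ℕ} (i j : Fin n) (h : (j - i).val = 1) (hn : 3 ≤ n) :
    (j : ℕ) = i + 1 ∨ ((i : ℕ) + 1 = n ∧ (j : ℕ) = 0) := by
  rw [Fin.val_sub] at h
  have hi := i.2
  have hj := j.2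
  by_cases hle : (i : ℕ) ≤ j
  · have : n - (i : ℕ) + j = n + (j - i) := by omega
    rw [this, Nat.add_mod_left, Nat.mod_eq_of_lt (by omega)] at h
    omega
  · rw [Nat.mod_eq_of_lt (by omega)] at h
    omega

theorem gg_cycle (hk : 3 ≤ k) (h1 : k ≤ m₁) (h2 : k ≤ m₂) :
    HasCycleLength (Ggraph k m₁ m₂) (2 * k + 2) := by
  let φ : SimpleGraph.cycleGraph (2 * k - 1 + 3) →g Ggraph k m₁ m₂ :=
    { toFun := fun i => ggf hk h1 h2 (Fin.cast (by omega) i)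
      map_rel' := by
        intro a b hab
        rcases SimpleGraph.cycleGraph_adj'.1 hab with h | h
        · apply SimpleGraph.Adj.symm
          apply ggf_adj
          have := fin_sub_one _ _ h (by omega)
          simp only [Fin.val_cast]
          omega
        · apply ggf_adj
          have := fin_sub_one _ _ h (by omega)
          simp only [Fin.val_cast]
          omega }
  have hφ : Function.Injective φ := by
    intro a b h
    exact Fin.cast_injective _ (ggf_inj hk h1 h2 h)
  refine ⟨_, (SimpleGraph.cycleGraph.cycle (2 * k - 1)).map φ,
    SimpleGraph.cycleGraph.isCycle_cycle.map hφ, ?_⟩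
  rw [SimpleGraph.Walk.length_map, SimpleGraph.cycleGraph.length_cycle]
  omega

def ggY : Fin (k - 1) ⊕ ((Fin m₁ ⊕ Fin m₂) ⊕ Fin 2) → Bool
  | Sum.inr (Sum.inl _) => true
  | _ => false

theorem gg_count (hk : 3 ≤ k) (l : List (Fin (k - 1) ⊕ ((Fin m₁ ⊕ Fin m₂) ⊕ Fin 2)))
    (hl : l.Nodup) : l.countP (fun v => !ggY v) ≤ k + 1 := by
  rw [List.countP_eq_length_filter, ← List.toFinset_card_of_nodup (hl.filter _)]
  let f : Fin (k - 1) ⊕ Fin 2 → Fin (k - 1) ⊕ ((Fin m₁ ⊕ Fin m₂) ⊕ Fin 2) :=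
    Sum.elim Sum.inl (fun x => Sum.inr (Sum.inr x))
  calc _ ≤ (Finset.univ.image f).card := by
        apply Finset.card_le_card
        intro v hv
        simp only [List.mem_toFinset, List.mem_filter] at hv
        rcases v with a | y | a
        · exact Finset.mem_image.2 ⟨Sum.inl a, Finset.mem_univ _, rfl⟩
        · simp [ggY] at hv
        · exact Finset.mem_image.2 ⟨Sum.inr a, Finset.mem_univ _, rfl⟩
    _ ≤ _ := Finset.card_image_le
    _ ≤ k + 1 := by simp; omega

theorem gg_bound (hk : 3 ≤ k) (u) (c : (Ggraph k m₁ m₂).Walk u u) (hc : c.IsCycle) :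
    c.length ≤ 2 * k + 2 := by
  have A := gg_count hk _ hc.support_nodup
  have B := gg_count hk _ hc.nodup_dropLast_support
  rw [← SimpleGraph.Walk.map_snd_darts, List.countP_map] at A
  rw [← SimpleGraph.Walk.map_fst_darts, List.countP_map] at B
  have C := List.length_eq_countP_add_countP (fun d : (Ggraph k m₁ m₂).Dart => !ggY d.fst)
    (l := c.darts)
  have D : c.darts.countP (fun d => ¬ ((!ggY d.fst) = true)) ≤
      c.darts.countP ((fun v => !ggY v) ∘ fun d => d.snd) := by
    apply List.countP_mono_left
    rintro ⟨⟨a, b⟩, hab⟩ _ h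
    rcases a with a | a | a <;> rcases b with b | b | b <;> simp [ggY] at h ⊢
    exact gg_YY _ _ hab
  have E : c.darts.countP (fun d => !ggY d.fst) =
    c.darts.countP ((fun v => !ggY v) ∘ fun d => d.fst) := rfl
  rw [SimpleGraph.Walk.length_darts] at C
  omega

end helpers

/-- For `k ≥ 3` and `m = m₁ + m₂ ≥ 2k` with `m₁, m₂ ≥ k`, the graph `G_{k,m}` is a
2-connected triangle-free graph of minimum degree at least `k` whose longest cycles have
length exactly `2k + 2`. -/
theorem stmt_14 (k m m₁ m₂ : ℕ) (hk : 3 ≤ k) (hm : m = m₁ + m₂) (hm2k : 2 * k ≤ m)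
    (h1 : k ≤ m₁) (h2 : k ≤ m₂) :
    TwoConnected (Ggraph k m₁ m₂) ∧
    (Ggraph k m₁ m₂).CliqueFree 3 ∧
    (∀ v, k ≤ ((Ggraph k m₁ m₂).neighborSet v).ncard) ∧
    HasCycleLength (Ggraph k m₁ m₂) (2 * k + 2) ∧
    ∀ ℓ : ℕ, 2 * k + 2 < ℓ → ¬ HasCycleLength (Ggraph k m₁ m₂) ℓ := by
  exact ⟨gg_two hk h1 h2, gg_cliqueFree, gg_deg hk h1 h2, gg_cycle hk h1 h2, by
    rintro ℓ hℓ ⟨u, c, hc, rfl⟩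
    have := gg_bound hk u c hc
    omega⟩
end
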